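/- Let H ∈ (0, 1/2). Then the function T ↦ M(T)/2 has the oblique asymptote with slope σ² and y-intercept −((4H−1)/2)·σ² − (2H−1)(2H+1)·a²; that is, lim_{T→∞} [M(T)/2 − σ²·T] = −((4H−1)/2)·σ² − (2H−1)(2H+1)·a². -/

import Mathlib

open Real MeasureTheory intervalIntegral

noncomputable def I1 (H T : ℝ) : ℝ :=
  ∫ t₁ in (0:ℝ)..T, ∫ t₂ in (0:ℝ)..T, ∫ s₁ in (0:ℝ)..T, ∫ s₂ in (0:ℝ)..T,
    Real.exp (-|t₁ - s₁| - |t₂ - s₂|) * Real.sign (s₁ - t₁) * Real.sign (t₂ - s₂) *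
      (Real.sign (t₂ - t₁) * |t₂ - t₁| ^ (2 * H - 1)) *
      (Real.sign (s₁ - s₂) * |s₁ - s₂| ^ (2 * H - 1))

noncomputable def I2 (H T : ℝ) : ℝ :=
  2 * ∫ t₁ in (0:ℝ)..T, ∫ t₂ in (0:ℝ)..T, ∫ s₁ in (0:ℝ)..T,
    Real.exp (-|t₁ - s₁| - t₂) * Real.sign (s₁ - t₁) *
      (Real.sign (t₂ - t₁) * |t₂ - t₁| ^ (2 * H - 1)) * s₁ ^ (2 * H - 1)

noncomputable def I3 (H T : ℝ) : ℝ :=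
  2 * (∫ u in (0:ℝ)..T, Real.exp (-u) * u ^ (2 * H - 1)) ^ 2 +
    2 * (Real.exp (-T) * ∫ u in (0:ℝ)..T, Real.exp u * u ^ (2 * H - 1)) ^ 2

/-- `fBmNormSqM H T` is the squared norm `‖f_T‖²` for `H ∈ (0,1/2)`. -/
noncomputable def fBmNormSqM (H T : ℝ) : ℝ := H ^ 2 * (I1 H T + 2 * I2 H T + I3 H T)

/-- `σ_H²`, with the value at `H = 1/4` interpreted as the limit `2/π`. -/
noncomputable def sigmaH2 (H : ℝ) : ℝ :=
  if H = 1/4 then 2 / π else (4 * H - 1) * (1 - 1 / Real.cos (2 * H * π))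

section FourfoldIntegralAsymptotics

open Filter Set Topology

/-- The lower incomplete Gamma function `∫₀ˣ e^{-u} u^β du`. -/
noncomputable def lowerGamma (β x : ℝ) : ℝ := ∫ u in (0:ℝ)..x, exp (-u) * u ^ β

/-- The convolution `∫₀ˣ e^{-(x-u)} u^β du`. -/
noncomputable def expConv (β x : ℝ) : ℝ := exp (-x) * ∫ u in (0:ℝ)..x, exp u * u ^ β

/-- The forward convolution `∫ₓ^∞ e^{-(u-x)} u^β du`. -/
noncomputable def expTail (β x : ℝ) : ℝ := exp x * (Gamma (β + 1) - lowerGamma β x)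

section Basic

variable {β : ℝ}

lemma intervalIntegrable_continuous_mul_rpow (hβ : -1 < β) {f : ℝ → ℝ} {a b : ℝ}
    (hf : ContinuousOn f (uIcc a b)) :
    IntervalIntegrable (fun u => f u * u ^ β) volume a b :=
  (intervalIntegrable_rpow' hβ).continuousOn_mul hf

lemma continuous_lowerGamma (hβ : -1 < β) : Continuous (lowerGamma β) :=
  continuous_primitive (fun _ _ => intervalIntegrable_continuous_mul_rpow hβ (by fun_prop)) 0

lemma continuous_expConv (hβ : -1 < β) : Continuous (expConv β) :=
  (by fun_prop : Continuous fun x : ℝ => exp (-x)).mul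
    (continuous_primitive
      (fun _ _ => intervalIntegrable_continuous_mul_rpow hβ (by fun_prop)) 0)

lemma continuous_expTail (hβ : -1 < β) : Continuous (expTail β) := by
  have := continuous_lowerGamma hβ
  unfold expTail
  fun_prop

@[simp] lemma lowerGamma_zero : lowerGamma β 0 = 0 := by simp [lowerGamma]

@[simp] lemma expConv_zero : expConv β 0 = 0 := by simp [expConv]

@[simp] lemma expTail_zero : expTail β 0 = Gamma (β + 1) := by simp [expTail]

lemma hasDerivAt_integral_mul_rpow (hβ : -1 < β) {f : ℝ → ℝ} (hf : Continuous f) {x : ℝ}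
    (hx : 0 < x) :
    HasDerivAt (fun x => ∫ u in (0:ℝ)..x, f u * u ^ β) (f x * x ^ β) x := by
  refine integral_hasDerivAt_right
    (intervalIntegrable_continuous_mul_rpow hβ hf.continuousOn) ?_ ?_
  · exact Measurable.stronglyMeasurable (by fun_prop) |>.stronglyMeasurableAtFilter
  · exact hf.continuousAt.mul (continuousAt_rpow_const x β (Or.inl hx.ne'))

lemma hasDerivAt_lowerGamma (hβ : -1 < β) {x : ℝ} (hx : 0 < x) :
    HasDerivAt (lowerGamma β) (exp (-x) * x ^ β) x :=
  hasDerivAt_integral_mul_rpow hβ (by fun_prop) hx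

lemma hasDerivAt_expConv (hβ : -1 < β) {x : ℝ} (hx : 0 < x) :
    HasDerivAt (expConv β) (x ^ β - expConv β x) x := by
  have h1 := ((hasDerivAt_neg x).exp).mul
    (hasDerivAt_integral_mul_rpow hβ (f := exp) (by fun_prop) hx)
  refine h1.congr_deriv ?_
  have h2 : exp (-x) * exp x = 1 := by rw [← exp_add]; simp
  simp only [expConv]
  linear_combination x ^ β * h2

lemma hasDerivAt_expTail (hβ : -1 < β) {x : ℝ} (hx : 0 < x) :
    HasDerivAt (expTail β) (expTail β x - x ^ β) x := by
  have h1 := (hasDerivAt_exp x).mul ((hasDerivAt_lowerGamma hβ hx).const_sub (Gamma (β + 1)))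
  refine h1.congr_deriv ?_
  have h2 : exp (-x) * exp x = 1 := by rw [← exp_add]; simp
  simp only [expTail]
  linear_combination - x ^ β * h2

lemma Gamma_sub_lowerGamma (x : ℝ) :
    Gamma (β + 1) - lowerGamma β x = exp (-x) * expTail β x := by
  rw [expTail, ← mul_assoc, ← exp_add]; simp

lemma tendsto_lowerGamma (hβ : -1 < β) :
    Tendsto (lowerGamma β) atTop (𝓝 (Gamma (β + 1))) := by
  rw [Gamma_eq_integral (by linarith)]
  have := GammaIntegral_convergent (s := β + 1) (by linarith)
  simp only [add_sub_cancel_right] at this ⊢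
  exact intervalIntegral_tendsto_integral_Ioi 0 this tendsto_id

lemma nonneg_of_deriv_nonpos_of_tendsto_zero {f f' : ℝ → ℝ} {a : ℝ}
    (hf : ∀ x, a < x → HasDerivAt f (f' x) x) (hf' : ∀ x, a < x → f' x ≤ 0)
    (hlim : Tendsto f atTop (𝓝 0)) {x : ℝ} (hx : a < x) : 0 ≤ f x := by
  have hanti : AntitoneOn f (Ioi a) :=
    antitoneOn_of_deriv_nonpos (convex_Ioi a)
      (fun y hy => (hf y hy).continuousAt.continuousWithinAt)
      (fun y hy => (hf y (by simpa using hy)).differentiableAt.differentiableWithinAt)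
      (fun y hy => by
        rw [interior_Ioi] at hy
        rw [(hf y hy).deriv]; exact hf' y hy)
  refine le_of_tendsto hlim ?_
  filter_upwards [eventually_ge_atTop x] with y hy
  exact hanti hx (lt_of_lt_of_le hx hy) hy

lemma expTail_le (hβ : -1 < β) (hβ0 : β < 0) {x : ℝ} (hx : 0 < x) : expTail β x ≤ x ^ β := by
  have key := nonneg_of_deriv_nonpos_of_tendsto_zero (a := 0)
    (f := fun x => exp (-x) * x ^ β - (Gamma (β + 1) - lowerGamma β x))
    (f' := fun x => exp (-x) * (β * x ^ (β - 1))) ?_ ?_ ?_ hx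
  · rw [Gamma_sub_lowerGamma, ← mul_sub] at key
    linarith [(mul_nonneg_iff_of_pos_left (exp_pos (-x))).1 key]
  · intro y hy
    refine ((((hasDerivAt_neg y).exp).mul (hasDerivAt_rpow_const (Or.inl hy.ne'))).sub
      ((hasDerivAt_lowerGamma hβ hy).const_sub _)).congr_deriv ?_
    ring
  · intro y hy
    have := rpow_nonneg hy.le (β - 1)
    have := exp_pos (-y)
    exact mul_nonpos_of_nonneg_of_nonpos this.le (mul_nonpos_of_nonpos_of_nonneg hβ0.le (by assumption))
  · have h1 : Tendsto (fun x : ℝ => exp (-x) * x ^ β) atTop (𝓝 0) := by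
      simpa [mul_comm] using tendsto_rpow_mul_exp_neg_mul_atTop_nhds_zero β 1 one_pos
    simpa using h1.sub ((tendsto_lowerGamma hβ).const_sub (Gamma (β + 1)))

lemma le_expTail (hβ : -1 < β) (hβ0 : β < 0) {x : ℝ} (hx : 0 < x) :
    x ^ β + β * x ^ (β - 1) ≤ expTail β x := by
  have key := nonneg_of_deriv_nonpos_of_tendsto_zero (a := 0)
    (f := fun x => (Gamma (β + 1) - lowerGamma β x) - exp (-x) * (x ^ β + β * x ^ (β - 1)))
    (f' := fun x => - (exp (-x) * (β * ((β - 1) * x ^ (β - 1 - 1))))) ?_ ?_ ?_ hx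
  · rw [Gamma_sub_lowerGamma, ← mul_sub] at key
    linarith [(mul_nonneg_iff_of_pos_left (exp_pos (-x))).1 key]
  · intro y hy
    refine (((hasDerivAt_lowerGamma hβ hy).const_sub _).sub (((hasDerivAt_neg y).exp).mul
      ((hasDerivAt_rpow_const (Or.inl hy.ne')).add
        ((hasDerivAt_rpow_const (Or.inl hy.ne')).const_mul β)))).congr_deriv ?_
    simp only [Pi.add_apply]
    ring
  · intro y hy
    have h1 := rpow_nonneg hy.le (β - 1 - 1)
    have h2 := exp_pos (-y)
    have h3 : 0 ≤ β * (β - 1) := by nlinarith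
    have := mul_nonneg h2.le (mul_nonneg h3 h1)
    linarith
  · have h1 : ∀ s : ℝ, Tendsto (fun x : ℝ => exp (-x) * x ^ s) atTop (𝓝 0) := fun s => by
      simpa [mul_comm] using tendsto_rpow_mul_exp_neg_mul_atTop_nhds_zero s 1 one_pos
    have := (((tendsto_lowerGamma hβ).const_sub (Gamma (β + 1)))).sub
      ((h1 β).add ((h1 (β - 1)).const_mul β))
    simp only [sub_self, mul_zero, add_zero] at this
    refine this.congr fun x => ?_
    ring

lemma expTail_sub_rpow_isBigO (hβ : -1 < β) (hβ0 : β < 0) :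
    (fun x => expTail β x - x ^ β) =O[atTop] fun x => x ^ (β - 1) := by
  refine Asymptotics.IsBigO.of_bound 1 ?_
  filter_upwards [eventually_gt_atTop 0] with x hx
  have h1 := expTail_le hβ hβ0 hx
  have h2 := le_expTail hβ hβ0 hx
  have h3 := rpow_nonneg hx.le (β - 1)
  rw [norm_eq_abs, norm_eq_abs, abs_of_nonneg h3, abs_le]
  constructor <;> nlinarith

lemma expConv_sub_rpow_isBigO (hβ : -1 < β) (hβ0 : β < 0) :
    (fun x => expConv β x - x ^ β) =O[atTop] fun x => x ^ (β - 1) := by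
  set F : ℝ → ℝ := fun x => (∫ u in (0:ℝ)..x, exp u * u ^ β) - exp x * x ^ β with hF
  have hFd : ∀ x, 0 < x → HasDerivAt F (- (exp x * (β * x ^ (β - 1)))) x := fun x hx => by
    refine ((hasDerivAt_integral_mul_rpow hβ (f := exp) (by fun_prop) hx).sub
      ((hasDerivAt_exp x).mul (hasDerivAt_rpow_const (Or.inl hx.ne')))).congr_deriv ?_
    ring
  set G : ℝ → ℝ := fun x => 2 * exp x * x ^ (β - 1) - F x with hG
  have hGd : ∀ x, 0 < x → HasDerivAt G
      (2 * exp x * x ^ (β - 1) + 2 * exp x * ((β - 1) * x ^ (β - 1 - 1))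
        + exp x * (β * x ^ (β - 1))) x := fun x hx => by
    refine ((((hasDerivAt_exp x).const_mul 2).mul
      (hasDerivAt_rpow_const (Or.inl hx.ne'))).sub (hFd x hx)).congr_deriv ?_
    ring
  have hFm : MonotoneOn F (Ici 4) :=
    monotoneOn_of_deriv_nonneg (convex_Ici 4)
      (fun y hy => (hFd y (by simp at hy; linarith)).continuousAt.continuousWithinAt)
      (fun y hy => (hFd y (by simp at hy; linarith)).differentiableAt.differentiableWithinAt)
      (fun y hy => by
        rw [interior_Ici, mem_Ioi] at hy
        have hy0 : 0 < y := by linarith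
        rw [(hFd y hy0).deriv]
        have h1 := rpow_nonneg hy0.le (β - 1)
        have h2 := mul_nonneg (exp_pos y).le (mul_nonneg (neg_nonneg.2 hβ0.le) h1)
        linarith)
  have hGm : MonotoneOn G (Ici 4) :=
    monotoneOn_of_deriv_nonneg (convex_Ici 4)
      (fun y hy => (hGd y (by simp at hy; linarith)).continuousAt.continuousWithinAt)
      (fun y hy => (hGd y (by simp at hy; linarith)).differentiableAt.differentiableWithinAt)
      (fun y hy => by
        rw [interior_Ici, mem_Ioi] at hy
        have hy0 : 0 < y := by linarith
        rw [(hGd y hy0).deriv]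
        have h1 := rpow_nonneg hy0.le (β - 1 - 1)
        have h3 : y ^ (β - 1) = y * y ^ (β - 1 - 1) := by
          rw [rpow_sub_one hy0.ne' (β - 1)]; field_simp
        rw [h3]
        have h4 : 0 ≤ 2 * y + 2 * (β - 1) + β * y := by nlinarith
        have h2 := mul_nonneg (exp_pos y).le (mul_nonneg h4 h1)
        linarith)
  have hexp : (fun x : ℝ => exp (-x)) =O[atTop] fun x : ℝ => x ^ (β - 1) := by
    simpa using (isLittleO_exp_neg_mul_rpow_atTop one_pos (β - 1)).isBigO
  have hsum : (fun x : ℝ => (|F 4| + |G 4|) * exp (-x) + 2 * x ^ (β - 1))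
      =O[atTop] fun x : ℝ => x ^ (β - 1) :=
    (hexp.const_mul_left _).add ((Asymptotics.isBigO_refl _ _).const_mul_left 2)
  refine Asymptotics.IsBigO.trans (Asymptotics.IsBigO.of_bound 1 ?_) hsum
  filter_upwards [eventually_ge_atTop 4] with x hx
  have hx0 : 0 < x := by linarith
  have e1 : exp (-x) * exp x = 1 := by rw [← exp_add]; simp
  have h0 : expConv β x - x ^ β = exp (-x) * F x := by
    simp only [expConv, hF]; linear_combination x ^ β * e1
  have h1 := hFm (by simp : (4:ℝ) ∈ Ici 4) hx hx
  have h2 := hGm (by simp : (4:ℝ) ∈ Ici 4) hx hx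
  have h3 := rpow_nonneg hx0.le (β - 1)
  have h4 := exp_pos (-x)
  have h5 : exp (-x) * F x ≤ exp (-x) * |G 4| + 2 * x ^ (β - 1) := by
    have : F x = 2 * exp x * x ^ (β - 1) - G x := by simp [hG]
    rw [this]
    have h6 := mul_le_mul_of_nonneg_left ((neg_le_neg h2).trans (neg_le_abs _)) h4.le
    linear_combination h6 + 2 * x ^ (β - 1) * e1
  have h6 : - (exp (-x) * |F 4|) ≤ exp (-x) * F x := by
    have := mul_le_mul_of_nonneg_left ((neg_abs_le _).trans h1) h4.le
    linarith
  have h7 := mul_nonneg h4.le (abs_nonneg (F 4))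
  have h8 := mul_nonneg h4.le (abs_nonneg (G 4))
  rw [h0, one_mul, norm_eq_abs, norm_eq_abs, abs_of_nonneg (a := _ + _) (by nlinarith), abs_le]
  constructor <;> nlinarith

lemma tendsto_expTail (hβ : -1 < β) (hβ0 : β < 0) : Tendsto (expTail β) atTop (𝓝 0) := by
  have h1 := (expTail_sub_rpow_isBigO hβ hβ0).trans_tendsto
    (by simpa using tendsto_rpow_neg_atTop (y := 1 - β) (by linarith))
  have h2 : Tendsto (fun x : ℝ => x ^ β) atTop (𝓝 0) := by
    simpa using tendsto_rpow_neg_atTop (y := -β) (by linarith)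
  simpa using h1.add h2

lemma tendsto_expConv (hβ : -1 < β) (hβ0 : β < 0) : Tendsto (expConv β) atTop (𝓝 0) := by
  have h1 := (expConv_sub_rpow_isBigO hβ hβ0).trans_tendsto
    (by simpa using tendsto_rpow_neg_atTop (y := 1 - β) (by linarith))
  have h2 : Tendsto (fun x : ℝ => x ^ β) atTop (𝓝 0) := by
    simpa using tendsto_rpow_neg_atTop (y := -β) (by linarith)
  simpa using h1.add h2

lemma exists_abs_le_of_tendsto {f : ℝ → ℝ} {l : ℝ} (hf : ContinuousOn f (Ici 0))
    (hl : Tendsto f atTop (𝓝 l)) : ∃ C, 0 ≤ C ∧ ∀ x, 0 ≤ x → |f x| ≤ C := by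
  obtain ⟨a, ha⟩ := eventually_atTop.1 (hl.abs.eventually (ge_mem_nhds (lt_add_one |l|)))
  obtain ⟨C, hC⟩ := (isCompact_Icc (a := 0) (b := a)).exists_bound_of_continuousOn
    (hf.mono Icc_subset_Ici_self)
  refine ⟨max C (|l| + 1), le_max_of_le_right (by positivity), fun x hx => ?_⟩
  rcases le_total x a with h | h
  · exact (hC x ⟨hx, h⟩).trans (le_max_left _ _)
  · exact (ha x h).trans (le_max_right _ _)

end Basic

section Antiderivatives

variable {β : ℝ}

lemma integral_eq_sub_of_hasDerivAt_Ioo {F F' : ℝ → ℝ} {T : ℝ} (hT : 0 ≤ T)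
    (hF : ContinuousOn F (Icc 0 T)) (hd : ∀ x, 0 < x → HasDerivAt F (F' x) x)
    (hi : IntervalIntegrable F' volume 0 T) :
    ∫ x in (0:ℝ)..T, F' x = F T - F 0 :=
  integral_eq_sub_of_hasDerivAt_of_le hT hF (fun x hx => hd x hx.1) hi

lemma continuous_rpow_succ (hβ : -1 < β) : Continuous fun x : ℝ => x ^ (β + 1) :=
  continuous_id.rpow_const fun _ => Or.inr (by linarith)

lemma hasDerivAt_rpow_succ {x : ℝ} (hx : 0 < x) :
    HasDerivAt (fun x : ℝ => x ^ (β + 1)) ((β + 1) * x ^ β) x := by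
  simpa using hasDerivAt_rpow_const (p := β + 1) (Or.inl hx.ne')

lemma tendsto_mul_of_isBigO (hβ0 : β < 0) {f : ℝ → ℝ}
    (hf : f =O[atTop] fun x => x ^ (β - 1)) :
    Tendsto (fun x => x * f x) atTop (𝓝 0) := by
  refine ((Asymptotics.isBigO_refl (fun x : ℝ => x) atTop).mul hf).trans_tendsto ?_
  have h2 : Tendsto (fun x : ℝ => x ^ β) atTop (𝓝 0) := by
    simpa using tendsto_rpow_neg_atTop (y := -β) (by linarith)
  refine h2.congr' ?_
  filter_upwards [eventually_gt_atTop 0] with x hx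
  rw [rpow_sub_one hx.ne']
  field_simp

lemma tendsto_rpow_of_neg (hβ0 : β < 0) : Tendsto (fun x : ℝ => x ^ β) atTop (𝓝 0) := by
  simpa using tendsto_rpow_neg_atTop (y := -β) (by linarith)

lemma tendsto_rpow_mul_exp_neg (s : ℝ) :
    Tendsto (fun x : ℝ => x ^ s * exp (-x)) atTop (𝓝 0) := by
  simpa using tendsto_rpow_mul_exp_neg_mul_atTop_nhds_zero s 1 one_pos

/-- The difference of the backward and forward convolutions. -/
noncomputable def convDiff (β x : ℝ) : ℝ := expConv β x - expTail β x

lemma continuous_convDiff (hβ : -1 < β) : Continuous (convDiff β) :=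
  (continuous_expConv hβ).sub (continuous_expTail hβ)

/-- The truncated squared norm of `convDiff`. -/
noncomputable def sqInt (β T : ℝ) : ℝ := ∫ x in (0:ℝ)..T, convDiff β x ^ 2

lemma hasDerivAt_sqInt (hβ : -1 < β) (x : ℝ) :
    HasDerivAt (sqInt β) (convDiff β x ^ 2) x :=
  integral_hasDerivAt_right (((continuous_convDiff hβ).pow 2).intervalIntegrable _ _)
    ((continuous_convDiff hβ).pow 2).stronglyMeasurable.stronglyMeasurableAtFilter
    ((continuous_convDiff hβ).pow 2).continuousAt

lemma continuous_sqInt (hβ : -1 < β) : Continuous (sqInt β) :=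
  continuous_iff_continuousAt.2 fun x => (hasDerivAt_sqInt hβ x).continuousAt

lemma sqInt_eq (hβ : -1 < β) {T : ℝ} (hT : 0 ≤ T) :
    sqInt β T = 2 * (∫ x in (0:ℝ)..T, ((x - β) * expTail β x - x ^ (β + 1)) * x ^ β)
      + (-(1 / 2) * expConv β T ^ 2 + 1 / 2 * expTail β T ^ 2
        - 2 * T * expConv β T * expTail β T + 2 * T ^ (β + 1) * expConv β T
        + (2 * β + 1) * expConv β T * expTail β T) - 1 / 2 * Gamma (β + 1) ^ 2 := by
  have hg := continuous_expConv hβ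
  have hh := continuous_expTail hβ
  have hu := continuous_rpow_succ hβ
  have hq := continuous_convDiff hβ
  have hi : IntervalIntegrable (fun x => ((x - β) * expTail β x - x ^ (β + 1)) * x ^ β)
      volume 0 T := intervalIntegrable_continuous_mul_rpow hβ (by fun_prop)
  have hi2 : IntervalIntegrable (fun x => convDiff β x ^ 2) volume 0 T :=
    (by fun_prop : Continuous fun x => convDiff β x ^ 2).intervalIntegrable _ _
  have key := integral_eq_sub_of_hasDerivAt_Ioo hT
    (F := fun x => -(1 / 2) * expConv β x ^ 2 + 1 / 2 * expTail β x ^ 2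
        - 2 * x * expConv β x * expTail β x + 2 * x ^ (β + 1) * expConv β x
        + (2 * β + 1) * expConv β x * expTail β x)
    (F' := fun x => convDiff β x ^ 2 - 2 * (((x - β) * expTail β x - x ^ (β + 1)) * x ^ β))
    (by fun_prop) ?_ (hi2.sub (hi.const_mul 2))
  · rw [intervalIntegral.integral_sub hi2 (hi.const_mul 2),
      intervalIntegral.integral_const_mul] at key
    have h0 : (0:ℝ) ^ (β + 1) = 0 := zero_rpow (by linarith)
    simp only [expConv_zero, expTail_zero, h0] at key
    rw [sqInt]
    linear_combination key
  · intro x hx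
    have dg := hasDerivAt_expConv hβ hx
    have dh := hasDerivAt_expTail hβ hx
    have du := hasDerivAt_rpow_succ (β := β) hx
    refine ((((((dg.pow 2).const_mul (-(1 / 2))).add ((dh.pow 2).const_mul (1 / 2))).sub
      ((((hasDerivAt_id x).const_mul 2).mul dg).mul dh)).add ((du.const_mul 2).mul dg)).add
      ((dg.const_mul (2 * β + 1)).mul dh)).congr_deriv ?_
    simp only [convDiff, id, Pi.mul_apply, rpow_add_one hx.ne']
    ring

lemma integral_expConv_mul_convDiff (hβ : -1 < β) {T : ℝ} (hT : 0 ≤ T) :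
    ∫ x in (0:ℝ)..T, expConv β x * convDiff β x =
      1 / 4 * (Gamma (β + 1) ^ 2 - (expConv β T + expTail β T) ^ 2) + 1 / 2 * sqInt β T := by
  have hg := continuous_expConv hβ
  have hh := continuous_expTail hβ
  have hq := continuous_convDiff hβ
  have hQ := continuous_sqInt hβ
  rw [integral_eq_sub_of_hasDerivAt_Ioo hT
    (F := fun x => -(1 / 4) * (expConv β x + expTail β x) ^ 2 + 1 / 2 * sqInt β x)
    (by fun_prop) ?_
    ((by fun_prop : Continuous fun x => expConv β x * convDiff β x).intervalIntegrable _ _)]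
  · simp [sqInt]; ring
  · intro x hx
    have dg := hasDerivAt_expConv hβ hx
    have dh := hasDerivAt_expTail hβ hx
    refine ((((dg.add dh).pow 2).const_mul _).add
      ((hasDerivAt_sqInt hβ x).const_mul _)).congr_deriv ?_
    simp only [convDiff, Pi.add_apply]
    ring

lemma integral_exp_mul_expConv (hβ : -1 < β) {T : ℝ} (hT : 0 ≤ T) :
    ∫ x in (0:ℝ)..T, exp x * expConv β x =
      exp T * ((T + β + 1) * expConv β T - T ^ (β + 1)) := by
  have hg := continuous_expConv hβ
  have hu := continuous_rpow_succ hβ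
  rw [integral_eq_sub_of_hasDerivAt_Ioo hT
    (F := fun x => exp x * ((x + β + 1) * expConv β x - x ^ (β + 1)))
    (by fun_prop) ?_ ((by fun_prop : Continuous _).intervalIntegrable _ _)]
  · simp [zero_rpow (by linarith : β + 1 ≠ 0)]
  · intro x hx
    have dg := hasDerivAt_expConv hβ hx
    have du := hasDerivAt_rpow_succ (β := β) hx
    refine ((hasDerivAt_exp x).mul (((((hasDerivAt_id x).add_const β).add_const 1).mul dg).sub
      du)).congr_deriv ?_
    simp only [id, Pi.mul_apply, Pi.sub_apply, rpow_add_one hx.ne']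
    ring

/-- The boundary term in the antiderivative of `mainPart`. -/
noncomputable def boundaryTerm (β x : ℝ) : ℝ :=
  (-(x / 4) + (β + 1 / 2) / 4) * expConv β x ^ 2 + (x / 4 - (β + 3 / 2) / 4) * expTail β x ^ 2
    + (x - x ^ 2 + (β + 1 / 2) * (β + 3 / 2)) * expConv β x * expTail β x
    + (x + β + 1 / 2) * x ^ (β + 1) * expConv β x
    + (x - (β + 3 / 2)) * x ^ (β + 1) * expTail β x - (x ^ (β + 1)) ^ 2

/-- The part of the triple integral that survives without the exponentially small corrections. -/
noncomputable def mainPart (β T : ℝ) : ℝ :=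
  1 / 4 * (Gamma (β + 1) ^ 2 - (expConv β T + expTail β T) ^ 2) + 1 / 2 * sqInt β T
    + expTail β T * ((T + β + 1) * expConv β T - T ^ (β + 1))

lemma continuous_mainPart (hβ : -1 < β) : Continuous (mainPart β) := by
  have hg := continuous_expConv hβ
  have hh := continuous_expTail hβ
  have hu := continuous_rpow_succ hβ
  have hQ := continuous_sqInt hβ
  unfold mainPart
  fun_prop

lemma integral_mainPart (hβ : -1 < β) {T : ℝ} (hT : 0 ≤ T) :
    ∫ t in (0:ℝ)..T, mainPart β t =
      T * (Gamma (β + 1) ^ 2 / 4 + sqInt β T / 2) - (β + 3 / 2) / 2 * sqInt β T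
        - boundaryTerm β T - (β + 3 / 2) / 4 * Gamma (β + 1) ^ 2 := by
  have hg := continuous_expConv hβ
  have hh := continuous_expTail hβ
  have hu := continuous_rpow_succ hβ
  have hQ := continuous_sqInt hβ
  rw [integral_eq_sub_of_hasDerivAt_Ioo hT
    (F := fun x => x * (Gamma (β + 1) ^ 2 / 4 + sqInt β x / 2) - (β + 3 / 2) / 2 * sqInt β x
        - boundaryTerm β x)
    (by unfold boundaryTerm; fun_prop) ?_ ((continuous_mainPart hβ).intervalIntegrable _ _)]
  · simp [zero_rpow (by linarith : β + 1 ≠ 0), boundaryTerm, sqInt]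
  · intro x hx
    have dg := hasDerivAt_expConv hβ hx
    have dh := hasDerivAt_expTail hβ hx
    have du := hasDerivAt_rpow_succ (β := β) hx
    have dQ := hasDerivAt_sqInt hβ x
    have dx := hasDerivAt_id x
    have dV : HasDerivAt (boundaryTerm β) _ x :=
      (((((((((dx.div_const 4).neg).add_const ((β + 1 / 2) / 4)).mul (dg.pow 2)).add
        (((dx.div_const 4).sub_const ((β + 3 / 2) / 4)).mul (dh.pow 2))).add
        ((((dx.sub (dx.pow 2)).add_const ((β + 1 / 2) * (β + 3 / 2))).mul dg).mul dh)).add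
        ((((dx.add_const β).add_const (1 / 2)).mul du).mul dg)).add
        (((dx.sub_const (β + 3 / 2)).mul du).mul dh)).sub (du.pow 2))
    refine (((dx.mul ((dQ.div_const 2).const_add (Gamma (β + 1) ^ 2 / 4))).sub
      (dQ.const_mul ((β + 3 / 2) / 2))).sub dV).congr_deriv ?_
    simp only [mainPart, convDiff, id, Pi.mul_apply, Pi.sub_apply, Pi.pow_apply,
      Pi.neg_apply, rpow_add_one hx.ne']
    ring

lemma tendsto_mul_expConv_sub (hβ : -1 < β) (hβ0 : β < 0) :
    Tendsto (fun x => x * (expConv β x - x ^ β)) atTop (𝓝 0) :=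
  tendsto_mul_of_isBigO hβ0 (expConv_sub_rpow_isBigO hβ hβ0)

lemma tendsto_mul_expTail_sub (hβ : -1 < β) (hβ0 : β < 0) :
    Tendsto (fun x => x * (expTail β x - x ^ β)) atTop (𝓝 0) :=
  tendsto_mul_of_isBigO hβ0 (expTail_sub_rpow_isBigO hβ hβ0)

lemma tendsto_boundaryTerm (hβ : -1 < β) (hβ0 : β < 0) :
    Tendsto (boundaryTerm β) atTop (𝓝 0) := by
  have hg := tendsto_expConv hβ hβ0
  have hh := tendsto_expTail hβ hβ0
  have hr := tendsto_mul_expConv_sub hβ hβ0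
  have he := tendsto_mul_expTail_sub hβ hβ0
  have hw := tendsto_rpow_of_neg hβ0
  have key := ((((((hg.pow 2).const_mul ((β + 1 / 2) / 4)).add
    ((hh.pow 2).const_mul (-(β + 3 / 2) / 4))).add
    ((hg.mul hh).const_mul ((β + 1 / 2) * (β + 3 / 2)))).sub (hr.mul he)).add
    (hr.mul (((hg.add hh).const_mul (-(1 / 4))).add (hw.const_mul (β + 3 / 2))))).add
    (he.mul (((hg.add hh).const_mul (1 / 4)).sub (hw.const_mul (β + 1 / 2)))) |>.add
    (hr.mul (hh.sub hw))
  simp only [ne_eq, OfNat.ofNat_ne_zero, not_false_eq_true, zero_pow, mul_zero, add_zero,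
    sub_zero] at key
  refine key.congr' ?_
  filter_upwards [eventually_gt_atTop 0] with x hx
  simp only [boundaryTerm, rpow_add_one hx.ne']
  ring

lemma tendsto_sqInt_sub (hβ : -1 < β) (hβ0 : β < 0) :
    Tendsto (fun T => sqInt β T
      - 2 * (∫ x in (0:ℝ)..T, ((x - β) * expTail β x - x ^ (β + 1)) * x ^ β)) atTop
      (𝓝 (-(1 / 2) * Gamma (β + 1) ^ 2)) := by
  have hg := tendsto_expConv hβ hβ0
  have hh := tendsto_expTail hβ hβ0
  have he := tendsto_mul_expTail_sub hβ hβ0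
  have key := ((((hg.pow 2).const_mul (-(1 / 2))).add ((hh.pow 2).const_mul (1 / 2))).sub
    ((hg.mul he).const_mul 2)).add ((hg.mul hh).const_mul (2 * β + 1)) |>.add_const
    (-(1 / 2) * Gamma (β + 1) ^ 2)
  simp only [ne_eq, OfNat.ofNat_ne_zero, not_false_eq_true, zero_pow, mul_zero, add_zero,
    sub_zero, zero_add] at key
  refine key.congr' ?_
  filter_upwards [eventually_gt_atTop 0] with x hx
  rw [sqInt_eq hβ hx.le]
  simp only [rpow_add_one hx.ne']
  ring

lemma tendsto_mainPart (hβ : -1 < β) (hβ0 : β < 0) {Q : ℝ}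
    (hQ : Tendsto (sqInt β) atTop (𝓝 Q)) :
    Tendsto (mainPart β) atTop (𝓝 (Gamma (β + 1) ^ 2 / 4 + Q / 2)) := by
  have hg := tendsto_expConv hβ hβ0
  have hh := tendsto_expTail hβ hβ0
  have hr := tendsto_mul_expConv_sub hβ hβ0
  have key := (((((hg.add hh).pow 2).const_sub (Gamma (β + 1) ^ 2)).const_mul (1 / 4)).add
    (hQ.const_mul (1 / 2))).add (hh.mul (hr.add (hg.const_mul (β + 1))))
  have h2 : 1 / 4 * (Gamma (β + 1) ^ 2 - (0 + 0) ^ 2) + 1 / 2 * Q + 0 * (0 + (β + 1) * 0)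
      = Gamma (β + 1) ^ 2 / 4 + Q / 2 := by ring
  rw [h2] at key
  refine key.congr' ?_
  filter_upwards [eventually_gt_atTop 0] with x hx
  simp only [mainPart, rpow_add_one hx.ne']
  ring

lemma convDiff_isBigO (hβ : -1 < β) (hβ0 : β < 0) :
    convDiff β =O[atTop] fun x => x ^ (β - 1) := by
  refine ((expConv_sub_rpow_isBigO hβ hβ0).sub (expTail_sub_rpow_isBigO hβ hβ0)).congr_left ?_
  intro x
  simp [convDiff]

lemma tendsto_mul_sqInt_sub (hβ : -1 < β) (hβ0 : β < 0) {Q : ℝ}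
    (hQ : Tendsto (sqInt β) atTop (𝓝 Q)) :
    Tendsto (fun T => T * (sqInt β T - Q)) atTop (𝓝 0) := by
  obtain ⟨C, hC⟩ := (convDiff_isBigO hβ hβ0).bound
  obtain ⟨N, hN⟩ := eventually_atTop.1 hC
  have h1 : ∀ x, max N 0 < x → 0 ≤ (Q - sqInt β x) := fun x hx =>
    nonneg_of_deriv_nonpos_of_tendsto_zero (f' := fun x => - convDiff β x ^ 2)
      (fun y _ => (hasDerivAt_sqInt hβ y).const_sub Q)
      (fun y _ => by nlinarith [sq_nonneg (convDiff β y)]) (by simpa using hQ.const_sub Q) hx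
  set D := C ^ 2 / (1 - 2 * β) with hD
  have hlim2 : Tendsto (fun x : ℝ => x ^ (2 * β - 1)) atTop (𝓝 0) :=
    tendsto_rpow_of_neg (by linarith)
  have h2 : ∀ x, max N 0 < x → 0 ≤ D * x ^ (2 * β - 1) - (Q - sqInt β x) := fun x hx =>
    nonneg_of_deriv_nonpos_of_tendsto_zero (f := fun x => D * x ^ (2 * β - 1) - (Q - sqInt β x))
      (f' := fun x => D * ((2 * β - 1) * x ^ (2 * β - 1 - 1)) - (- convDiff β x ^ 2))
      (fun y hy => ((hasDerivAt_rpow_const (Or.inl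
        ((le_max_right _ _).trans_lt hy).ne')).const_mul D).sub
        ((hasDerivAt_sqInt hβ y).const_sub Q))
      (fun y hy => by
        have hy0 : 0 < y := (le_max_right _ _).trans_lt hy
        have h3 := hN y ((le_max_left _ _).trans hy.le)
        have h4 : convDiff β y ^ 2 ≤ C ^ 2 * y ^ (2 * β - 1 - 1) := by
          have h5 : y ^ (2 * β - 1 - 1) = (y ^ (β - 1)) ^ 2 := by
            rw [← rpow_natCast, ← rpow_mul hy0.le]; congr 1; push_cast; ring
          rw [h5, ← mul_pow, ← sq_abs]
          rw [norm_eq_abs, norm_eq_abs, abs_of_nonneg (rpow_nonneg hy0.le _)] at h3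
          exact pow_le_pow_left₀ (abs_nonneg _) h3 2
        have h6 : D * (2 * β - 1) = - C ^ 2 := by
          rw [hD]; have : 1 - 2 * β ≠ 0 := by linarith
          field_simp; ring
        rw [← mul_assoc, h6]; linarith)
      (by simpa using (hlim2.const_mul D).sub (hQ.const_sub Q)) hx
  have h3 : Tendsto (fun x : ℝ => -(D * x ^ (2 * β))) atTop (𝓝 0) := by
    simpa using ((tendsto_rpow_of_neg (β := 2 * β) (by linarith)).const_mul D).neg
  refine tendsto_of_tendsto_of_tendsto_of_le_of_le' h3 tendsto_const_nhds ?_ ?_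
  · filter_upwards [eventually_gt_atTop (max N 0)] with x hx
    have hx0 : 0 < x := (le_max_right _ _).trans_lt hx
    have := mul_nonneg hx0.le (h2 x hx)
    have h4 : x ^ (2 * β) = x * x ^ (2 * β - 1) := by
      rw [rpow_sub_one hx0.ne']; field_simp
    rw [h4]; linarith
  · filter_upwards [eventually_gt_atTop (max N 0)] with x hx
    have hx0 : 0 < x := (le_max_right _ _).trans_lt hx
    have := mul_nonneg hx0.le (h1 x hx)
    linarith

end Antiderivatives

section Corrections

variable {β : ℝ}

lemma tendsto_pow_mul_exp_neg_mul_expTail (hβ : -1 < β) (hβ0 : β < 0) (n : ℕ) :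
    Tendsto (fun x => x ^ n * (exp (-x) * expTail β x)) atTop (𝓝 0) := by
  have h1 := (tendsto_rpow_mul_exp_neg n).mul (tendsto_expTail hβ hβ0)
  simp only [rpow_natCast, mul_zero] at h1
  exact h1.congr fun x => by ring

lemma tendsto_pow_mul_exp_neg_mul_expConv (hβ : -1 < β) (hβ0 : β < 0) (n : ℕ) :
    Tendsto (fun x => x ^ n * (exp (-x) * expConv β x)) atTop (𝓝 0) := by
  have h1 := (tendsto_rpow_mul_exp_neg n).mul (tendsto_expConv hβ hβ0)
  simp only [rpow_natCast, mul_zero] at h1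
  exact h1.congr fun x => by ring

lemma tendsto_pow_mul_rpow_mul_exp_neg (n : ℕ) :
    Tendsto (fun x : ℝ => x ^ n * (x ^ (β + 1) * exp (-x))) atTop (𝓝 0) := by
  refine (tendsto_rpow_mul_exp_neg (n + (β + 1))).congr' ?_
  filter_upwards [eventually_gt_atTop 0] with x hx
  rw [rpow_add hx, rpow_natCast, mul_assoc]

lemma hasDerivAt_expConv_decay (hβ : -1 < β) {x : ℝ} (hx : 0 < x) :
    HasDerivAt (fun x => exp (-x) * expConv β x)
      (exp (-x) * x ^ β - 2 * (exp (-x) * expConv β x)) x :=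
  (((hasDerivAt_neg x).exp).mul (hasDerivAt_expConv hβ hx)).congr_deriv (by ring)

lemma hasDerivAt_rpow_decay {x : ℝ} (hx : 0 < x) :
    HasDerivAt (fun x => x ^ (β + 1) * exp (-x))
      ((β + 1) * (exp (-x) * x ^ β) - x * (exp (-x) * x ^ β)) x :=
  ((hasDerivAt_rpow_succ hx).mul ((hasDerivAt_neg x).exp)).congr_deriv (by
    rw [rpow_add_one hx.ne']; ring)

lemma exp_neg_mul_convDiff (x : ℝ) : exp (-x) * convDiff β x =
    exp (-x) * expConv β x - (Gamma (β + 1) - lowerGamma β x) := by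
  rw [Gamma_sub_lowerGamma, convDiff]; ring

lemma integral_exp_neg_mul_convDiff (hβ : -1 < β) {T : ℝ} (hT : 0 ≤ T) :
    ∫ x in (0:ℝ)..T, exp (-x) * convDiff β x =
      1 / 2 * (lowerGamma β T - exp (-T) * expConv β T)
        - T * (Gamma (β + 1) - lowerGamma β T)
        - ((β + 1) * lowerGamma β T - T ^ (β + 1) * exp (-T)) := by
  have hg := continuous_expConv hβ
  have hh := continuous_lowerGamma hβ
  have hq := continuous_convDiff hβ
  have hu := continuous_rpow_succ hβ
  rw [integral_eq_sub_of_hasDerivAt_Ioo hT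
    (F := fun T => 1 / 2 * (lowerGamma β T - exp (-T) * expConv β T)
        - T * (Gamma (β + 1) - lowerGamma β T)
        - ((β + 1) * lowerGamma β T - T ^ (β + 1) * exp (-T)))
    (by fun_prop) ?_ ((by fun_prop : Continuous _).intervalIntegrable _ _)]
  · simp [zero_rpow (by linarith : β + 1 ≠ 0)]
  · intro x hx
    have dg := hasDerivAt_expConv_decay hβ hx
    have dh := hasDerivAt_lowerGamma hβ hx
    have du := hasDerivAt_rpow_decay (β := β) hx
    have dx := hasDerivAt_id x
    refine ((((dh.sub dg).const_mul (1 / 2)).sub (dx.mul (dh.const_sub (Gamma (β + 1))))).sub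
      ((dh.const_mul (β + 1)).sub du)).congr_deriv ?_
    simp only [exp_neg_mul_convDiff, id]
    ring

lemma tendsto_mul_integral_exp_neg_mul_convDiff (hβ : -1 < β) (hβ0 : β < 0) :
    Tendsto (fun T => T * ((∫ x in (0:ℝ)..T, exp (-x) * convDiff β x)
      + Gamma (β + 1) * (β + 1 / 2))) atTop (𝓝 0) := by
  have h := tendsto_pow_mul_exp_neg_mul_expTail hβ hβ0
  have g := tendsto_pow_mul_exp_neg_mul_expConv hβ hβ0
  have u := tendsto_pow_mul_rpow_mul_exp_neg (β := β)
  have key := ((((h 1).const_mul (β + 1 / 2)).sub ((g 1).const_mul (1 / 2))).sub (h 2)).add (u 1)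
  simp only [mul_zero, sub_zero, add_zero] at key
  refine key.congr' ?_
  filter_upwards [eventually_gt_atTop 0] with x hx
  rw [integral_exp_neg_mul_convDiff hβ hx.le, ← Gamma_sub_lowerGamma]
  ring

lemma tendsto_integral_exp_neg_mul_convDiff (hβ : -1 < β) (hβ0 : β < 0) :
    Tendsto (fun T => ∫ x in (0:ℝ)..T, exp (-x) * convDiff β x) atTop
      (𝓝 (-(Gamma (β + 1) * (β + 1 / 2)))) := by
  have h := (tendsto_inv_atTop_zero.mul (tendsto_mul_integral_exp_neg_mul_convDiff hβ hβ0)).sub_const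
    (Gamma (β + 1) * (β + 1 / 2))
  simp only [mul_zero, zero_sub] at h
  refine h.congr' ?_
  filter_upwards [eventually_gt_atTop 0] with x hx
  rw [← mul_assoc, inv_mul_cancel₀ hx.ne']
  ring

lemma tendsto_integral_mul_exp_neg_mul_convDiff (hβ : -1 < β) (hβ0 : β < 0) :
    Tendsto (fun T => ∫ x in (0:ℝ)..T, x * (exp (-x) * convDiff β x)) atTop
      (𝓝 (Gamma (β + 1) * (1 / 4 - (β + 1) ^ 2 / 2))) := by
  have hg := continuous_expConv hβ
  have hh := continuous_lowerGamma hβ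
  have hq := continuous_convDiff hβ
  have hu := continuous_rpow_succ hβ
  have formula : ∀ T, 0 ≤ T → ∫ x in (0:ℝ)..T, x * (exp (-x) * convDiff β x) =
      1 / 2 * (1 / 2 * (lowerGamma β T - exp (-T) * expConv β T) + (β + 1) * lowerGamma β T
        - T ^ (β + 1) * exp (-T) - T * (exp (-T) * expConv β T))
      - (1 / 2 * T ^ 2 * (Gamma (β + 1) - lowerGamma β T)
        + 1 / 2 * ((β + 2) * (β + 1) * lowerGamma β T
          - (β + 2) * (T ^ (β + 1) * exp (-T)) - T * (T ^ (β + 1) * exp (-T)))) := by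
    intro T hT
    rw [integral_eq_sub_of_hasDerivAt_Ioo hT
      (F := fun T => 1 / 2 * (1 / 2 * (lowerGamma β T - exp (-T) * expConv β T)
          + (β + 1) * lowerGamma β T
          - T ^ (β + 1) * exp (-T) - T * (exp (-T) * expConv β T))
        - (1 / 2 * T ^ 2 * (Gamma (β + 1) - lowerGamma β T)
          + 1 / 2 * ((β + 2) * (β + 1) * lowerGamma β T
            - (β + 2) * (T ^ (β + 1) * exp (-T)) - T * (T ^ (β + 1) * exp (-T)))))
      (by fun_prop) ?_ ((by fun_prop : Continuous _).intervalIntegrable _ _)]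
    · simp [zero_rpow (by linarith : β + 1 ≠ 0)]
    · intro x hx
      have dg := hasDerivAt_expConv_decay hβ hx
      have dh := hasDerivAt_lowerGamma hβ hx
      have du := hasDerivAt_rpow_decay (β := β) hx
      have dx := hasDerivAt_id x
      refine (((((((dh.sub dg).const_mul (1 / 2)).add (dh.const_mul (β + 1))).sub du).sub
        (dx.mul dg)).const_mul (1 / 2)).sub
        ((((dx.pow 2).const_mul (1 / 2)).mul (dh.const_sub (Gamma (β + 1)))).add
          ((((dh.const_mul ((β + 2) * (β + 1))).sub (du.const_mul (β + 2))).sub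
            (dx.mul du)).const_mul (1 / 2)))).congr_deriv ?_
      simp only [exp_neg_mul_convDiff, id, Pi.pow_apply, rpow_add_one hx.ne']
      ring
  have h := tendsto_pow_mul_exp_neg_mul_expTail hβ hβ0
  have g := tendsto_pow_mul_exp_neg_mul_expConv hβ hβ0
  have u := tendsto_pow_mul_rpow_mul_exp_neg (β := β)
  have key := ((((((h 0).const_mul (-(1 / 4) - (β + 1) / 2 + (β + 2) * (β + 1) / 2)).sub
    ((g 0).const_mul (1 / 4))).add ((u 0).const_mul ((β + 2) / 2 - 1 / 2))).sub
    ((g 1).const_mul (1 / 2))).sub ((h 2).const_mul (1 / 2))).add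
    ((u 1).const_mul (1 / 2)) |>.add_const (Gamma (β + 1) * (1 / 4 - (β + 1) ^ 2 / 2))
  simp only [mul_zero, sub_zero, add_zero, zero_add] at key
  refine key.congr' ?_
  filter_upwards [eventually_gt_atTop 0] with x hx
  rw [formula x hx.le, ← Gamma_sub_lowerGamma]
  ring

/-- The primitive of `lowerGamma`. -/
noncomputable def lowerGammaPrim (β T : ℝ) : ℝ :=
  (T - (β + 1)) * lowerGamma β T + T ^ (β + 1) * exp (-T)

lemma continuous_lowerGammaPrim (hβ : -1 < β) : Continuous (lowerGammaPrim β) := by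
  have hh := continuous_lowerGamma hβ
  have hu := continuous_rpow_succ hβ
  unfold lowerGammaPrim
  fun_prop

lemma hasDerivAt_lowerGammaPrim (hβ : -1 < β) {x : ℝ} (hx : 0 < x) :
    HasDerivAt (lowerGammaPrim β) (lowerGamma β x) x := by
  have dh := hasDerivAt_lowerGamma hβ hx
  have du := hasDerivAt_rpow_decay (β := β) hx
  have dx := hasDerivAt_id x
  refine (((dx.sub_const (β + 1)).mul dh).add du).congr_deriv ?_
  simp only [id]
  ring

@[simp] lemma lowerGammaPrim_zero (hβ : -1 < β) : lowerGammaPrim β 0 = 0 := by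
  simp [lowerGammaPrim, zero_rpow (by linarith : β + 1 ≠ 0)]

lemma integral_lowerGamma (hβ : -1 < β) {T : ℝ} (hT : 0 ≤ T) :
    ∫ x in (0:ℝ)..T, lowerGamma β x = lowerGammaPrim β T := by
  rw [integral_eq_sub_of_hasDerivAt_Ioo hT (continuous_lowerGammaPrim hβ).continuousOn
    (fun x hx => hasDerivAt_lowerGammaPrim hβ hx)
    ((continuous_lowerGamma hβ).intervalIntegrable _ _), lowerGammaPrim_zero hβ, sub_zero]

lemma tendsto_integral_mul_lowerGammaPrim (hβ : -1 < β) (hβ0 : β < 0) :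
    Tendsto (fun T => ∫ x in (0:ℝ)..T, (Gamma (β + 1) - lowerGamma β x) * lowerGammaPrim β x)
      atTop (𝓝 (Gamma (β + 1) ^ 2 * (β + 1) / 2)) := by
  have hh := continuous_lowerGamma hβ
  have hL := continuous_lowerGammaPrim hβ
  have hu := continuous_rpow_succ hβ
  have formula : ∀ T, 0 ≤ T →
      ∫ x in (0:ℝ)..T, (Gamma (β + 1) - lowerGamma β x) * lowerGammaPrim β x =
      Gamma (β + 1) * ((T ^ 2 / 2 - (β + 1) * T + (β + 1) * (β + 2) / 2) * lowerGamma β T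
        + 1 / 2 * (T - (β + 2)) * (T ^ (β + 1) * exp (-T))) - 1 / 2 * lowerGammaPrim β T ^ 2 := by
    intro T hT
    rw [integral_eq_sub_of_hasDerivAt_Ioo hT
      (F := fun T => Gamma (β + 1) * ((T ^ 2 / 2 - (β + 1) * T + (β + 1) * (β + 2) / 2)
          * lowerGamma β T + 1 / 2 * (T - (β + 2)) * (T ^ (β + 1) * exp (-T)))
          - 1 / 2 * lowerGammaPrim β T ^ 2)
      (by fun_prop) ?_ ((by fun_prop : Continuous _).intervalIntegrable _ _)]
    · simp [zero_rpow (by linarith : β + 1 ≠ 0), lowerGammaPrim_zero hβ]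
    · intro x hx
      have dL := hasDerivAt_lowerGammaPrim hβ hx
      have dh := hasDerivAt_lowerGamma hβ hx
      have du := hasDerivAt_rpow_decay (β := β) hx
      have dx := hasDerivAt_id x
      refine (((((((dx.pow 2).div_const 2).sub (dx.const_mul (β + 1))).add_const
        ((β + 1) * (β + 2) / 2)).mul dh).add
        (((dx.sub_const (β + 2)).const_mul (1 / 2)).mul du)).const_mul (Gamma (β + 1)) |>.sub
        ((dL.pow 2).const_mul (1 / 2))).congr_deriv ?_
      simp only [id, Pi.pow_apply, Pi.sub_apply, lowerGammaPrim, rpow_add_one hx.ne']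
      ring
  have h := tendsto_pow_mul_exp_neg_mul_expTail hβ hβ0
  have u := tendsto_pow_mul_rpow_mul_exp_neg (β := β)
  set b := β + 1
  set G := Gamma b
  have hd : Tendsto (fun T : ℝ => (T ^ 1 - b * T ^ 0) * (exp (-T) * expTail β T)) atTop (𝓝 0) := by
    simpa [sub_mul, mul_assoc] using (h 1).sub ((h 0).const_mul b)
  have hv : Tendsto (fun T : ℝ => (T ^ 1 - b * T ^ 0) * (T ^ (β + 1) * exp (-T))) atTop (𝓝 0) := by
    simpa [sub_mul, mul_assoc] using (u 1).sub ((u 0).const_mul b)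
  have h2 : Tendsto (fun T : ℝ => (T ^ 2 - 2 * b * T ^ 1 + b ^ 2 * T ^ 0)
      * (exp (-T) * expTail β T)) atTop (𝓝 0) := by
    simpa [sub_mul, add_mul, mul_assoc] using
      ((h 2).sub ((h 1).const_mul (2 * b))).add ((h 0).const_mul (b ^ 2))
  have key := ((((((h 2).const_mul (-(G / 2))).add ((h 1).const_mul (G * b))).sub
    ((h 0).const_mul (G * b * (β + 2) / 2))).add ((u 1).const_mul (G / 2))).sub
    ((u 0).const_mul (G / 2 * (β + 2)))).sub ((((((hd.pow 2).sub (h2.const_mul (2 * G))).add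
      (hv.const_mul (2 * G))).sub ((hd.mul (u 0)).const_mul 2)).add ((u 0).pow 2)).const_mul
      (1 / 2)) |>.add_const (G ^ 2 * b / 2)
  simp only [ne_eq, OfNat.ofNat_ne_zero, not_false_eq_true, zero_pow, mul_zero, sub_zero,
    add_zero, zero_add] at key
  refine key.congr' ?_
  filter_upwards [eventually_gt_atTop 0] with x hx
  rw [formula x hx.le, lowerGammaPrim, ← Gamma_sub_lowerGamma]
  simp only [G, b]
  ring

lemma tendsto_convolution_of_exp_bound {f k : ℝ → ℝ} {C D : ℝ}
    (hf : ∀ x, 0 ≤ x → |f x| ≤ C * exp (-x / 2)) (hk : ∀ x, 0 ≤ x → |k x| ≤ D * exp (-x / 2)) :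
    Tendsto (fun T => ∫ x in (0:ℝ)..T, f x * k (T - x)) atTop (𝓝 0) := by
  have hlim : Tendsto (fun T : ℝ => C * D * exp (-T / 2) * |T - 0|) atTop (𝓝 0) := by
    have := (tendsto_rpow_mul_exp_neg_mul_atTop_nhds_zero 1 (1 / 2) (by norm_num)).const_mul (C * D)
    rw [mul_zero] at this
    refine this.congr' ?_
    filter_upwards [eventually_ge_atTop 0] with T hT
    rw [sub_zero, abs_of_nonneg hT, rpow_one]
    ring_nf
  refine squeeze_zero_norm' ?_ hlim
  filter_upwards [eventually_ge_atTop 0] with T hT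
  refine norm_integral_le_of_norm_le_const fun x hx => ?_
  rw [uIoc_of_le hT] at hx
  have h1 := hf x hx.1.le
  have h2 := hk (T - x) (by linarith [hx.2])
  have h3 : exp (-T / 2) = exp (-x / 2) * exp (-(T - x) / 2) := by rw [← exp_add]; ring_nf
  rw [norm_mul, norm_eq_abs, norm_eq_abs, h3]
  calc |f x| * |k (T - x)| ≤ (C * exp (-x / 2)) * (D * exp (-(T - x) / 2)) :=
        mul_le_mul h1 h2 (abs_nonneg _) ((abs_nonneg _).trans h1)
    _ = _ := by ring

lemma exists_exp_half_bound {f : ℝ → ℝ} (hf : Continuous f)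
    (hl : Tendsto (fun x => exp (x / 2) * f x) atTop (𝓝 0)) :
    ∃ C, ∀ x, 0 ≤ x → |f x| ≤ C * exp (-x / 2) := by
  obtain ⟨C, -, hC⟩ := exists_abs_le_of_tendsto
    (by fun_prop : ContinuousOn (fun x => exp (x / 2) * f x) (Ici 0)) hl
  refine ⟨C, fun x hx => ?_⟩
  have h1 := hC x hx
  rw [abs_mul, abs_of_pos (exp_pos _)] at h1
  have h2 : exp (x / 2) * exp (-x / 2) = 1 := by rw [← exp_add]; ring_nf; simp
  have h3 := mul_le_mul_of_nonneg_right h1 (exp_pos (-x / 2)).le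
  linear_combination h3 - |f x| * h2

lemma tendsto_pow_mul_exp_half_mul {f : ℝ → ℝ} (n : ℕ) (hf : Tendsto f atTop (𝓝 0)) :
    Tendsto (fun x => exp (x / 2) * (x ^ n * (exp (-x) * f x))) atTop (𝓝 0) := by
  have h1 := (tendsto_rpow_mul_exp_neg_mul_atTop_nhds_zero n (1 / 2) (by norm_num)).mul hf
  simp only [rpow_natCast, mul_zero] at h1
  refine h1.congr fun x => ?_
  have : exp (-(1 / 2) * x) = exp (x / 2) * exp (-x) := by rw [← exp_add]; ring_nf
  rw [this]; ring

lemma exists_bound_exp_neg_mul_convDiff (hβ : -1 < β) (hβ0 : β < 0) :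
    ∃ C, ∀ x, 0 ≤ x → |exp (-x) * convDiff β x| ≤ C * exp (-x / 2) := by
  have hq := continuous_convDiff hβ
  refine exists_exp_half_bound (by fun_prop) ?_
  have h : Tendsto (convDiff β) atTop (𝓝 0) := by
    have := (tendsto_expConv hβ hβ0).sub (tendsto_expTail hβ hβ0)
    rwa [sub_zero] at this
  simpa using tendsto_pow_mul_exp_half_mul 0 h

lemma exists_bound_Gamma_sub_lowerGamma (hβ : -1 < β) (hβ0 : β < 0) :
    ∃ C, ∀ x, 0 ≤ x → |Gamma (β + 1) - lowerGamma β x| ≤ C * exp (-x / 2) := by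
  have hh := continuous_lowerGamma hβ
  refine exists_exp_half_bound (by fun_prop) ?_
  simp only [Gamma_sub_lowerGamma]
  simpa using tendsto_pow_mul_exp_half_mul 0 (tendsto_expTail hβ hβ0)

lemma exists_bound_lowerGammaPrim_sub (hβ : -1 < β) (hβ0 : β < 0) :
    ∃ C, ∀ x, 0 ≤ x →
      |lowerGammaPrim β x - Gamma (β + 1) * (x - (β + 1))| ≤ C * exp (-x / 2) := by
  have hh := continuous_lowerGammaPrim hβ
  refine exists_exp_half_bound (by fun_prop) ?_
  have h1 := tendsto_pow_mul_exp_half_mul 1 (tendsto_expTail hβ hβ0)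
  have h0 := tendsto_pow_mul_exp_half_mul 0 (tendsto_expTail hβ hβ0)
  have h2 := tendsto_rpow_mul_exp_neg_mul_atTop_nhds_zero (β + 1) (1 / 2) (by norm_num)
  have key := (h2.sub h1).add (h0.const_mul (β + 1))
  simp only [mul_zero, sub_zero, add_zero] at key
  refine key.congr fun x => ?_
  have : exp (-(1 / 2) * x) = exp (x / 2) * exp (-x) := by rw [← exp_add]; ring_nf
  rw [this, lowerGammaPrim, ← Gamma_sub_lowerGamma]
  ring

/-- The convolution correction in the triple integral. -/
noncomputable def corrConv (β t : ℝ) : ℝ :=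
  ∫ x in (0:ℝ)..t, exp (-x) * convDiff β x * lowerGamma β (t - x)

lemma tendsto_corrConv (hβ : -1 < β) (hβ0 : β < 0) :
    Tendsto (corrConv β) atTop (𝓝 (-(Gamma (β + 1) ^ 2 * (β + 1 / 2)))) := by
  have hq := continuous_convDiff hβ
  have hh := continuous_lowerGamma hβ
  obtain ⟨C, hC⟩ := exists_bound_exp_neg_mul_convDiff hβ hβ0
  obtain ⟨D, hD⟩ := exists_bound_Gamma_sub_lowerGamma hβ hβ0
  have h1 := ((tendsto_integral_exp_neg_mul_convDiff hβ hβ0).const_mul (Gamma (β + 1))).sub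
    (tendsto_convolution_of_exp_bound hC hD)
  have e : Gamma (β + 1) * -(Gamma (β + 1) * (β + 1 / 2)) - 0
      = -(Gamma (β + 1) ^ 2 * (β + 1 / 2)) := by ring
  rw [e] at h1
  refine h1.congr fun t => ?_
  rw [← intervalIntegral.integral_const_mul, ← intervalIntegral.integral_sub
    ((by fun_prop : Continuous _).intervalIntegrable _ _)
    ((by fun_prop : Continuous _).intervalIntegrable _ _), corrConv]
  congr 1; ext x; ring

lemma corrConv_eq (hβ : -1 < β) {t T : ℝ} (ht : 0 ≤ t) (htT : t ≤ T) :
    corrConv β t =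
      ∫ x in (0:ℝ)..T, exp (-x) * convDiff β x * lowerGamma β (max (t - x) 0) := by
  have hq := continuous_convDiff hβ
  have hh := continuous_lowerGamma hβ
  rw [← integral_add_adjacent_intervals (b := t)
    ((by fun_prop : Continuous _).intervalIntegrable _ _)
    ((by fun_prop : Continuous _).intervalIntegrable _ _), corrConv]
  rw [intervalIntegral.integral_congr (a := t) (b := T) (g := fun _ => 0),
    intervalIntegral.integral_zero, add_zero]
  · refine intervalIntegral.integral_congr fun x hx => ?_
    rw [uIcc_of_le ht] at hx
    rw [max_eq_left (by linarith [hx.2])]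
  · intro x hx
    rw [uIcc_of_le htT] at hx
    simp only
    rw [max_eq_right (by linarith [hx.1])]
    simp

lemma continuous_corrConvKernel (hβ : -1 < β) : Continuous fun p : ℝ × ℝ =>
    exp (-p.2) * convDiff β p.2 * lowerGamma β (max (p.1 - p.2) 0) := by
  have hq := continuous_convDiff hβ
  have hh := continuous_lowerGamma hβ
  fun_prop

lemma intervalIntegrable_corrConv (hβ : -1 < β) {T : ℝ} (hT : 0 ≤ T) :
    IntervalIntegrable (corrConv β) volume 0 T := by
  have h : Continuous fun t => ∫ x in (0:ℝ)..T,
      exp (-x) * convDiff β x * lowerGamma β (max (t - x) 0) :=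
    continuous_parametric_intervalIntegral_of_continuous' (continuous_corrConvKernel hβ) 0 T
  refine (h.intervalIntegrable 0 T).congr fun t ht => ?_
  rw [uIoc_of_le hT] at ht
  exact (corrConv_eq hβ ht.1.le ht.2).symm

lemma integral_corrConv (hβ : -1 < β) {T : ℝ} (hT : 0 ≤ T) :
    ∫ t in (0:ℝ)..T, corrConv β t =
      ∫ x in (0:ℝ)..T, exp (-x) * convDiff β x * lowerGammaPrim β (T - x) := by
  have hq := continuous_convDiff hβ
  have hh := continuous_lowerGamma hβ
  have h1 : ∫ t in (0:ℝ)..T, corrConv β t = ∫ t in (0:ℝ)..T, ∫ x in (0:ℝ)..T,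
      exp (-x) * convDiff β x * lowerGamma β (max (t - x) 0) := by
    refine intervalIntegral.integral_congr fun t ht => ?_
    rw [uIcc_of_le hT] at ht
    exact corrConv_eq hβ ht.1 ht.2
  rw [h1, intervalIntegral_intervalIntegral_swap]
  · refine intervalIntegral.integral_congr fun x hx => ?_
    rw [uIcc_of_le hT] at hx
    rw [intervalIntegral.integral_const_mul, ← integral_lowerGamma hβ (by linarith [hx.2]),
      ← integral_add_adjacent_intervals (b := x)
      ((by fun_prop : Continuous _).intervalIntegrable _ _)
      ((by fun_prop : Continuous _).intervalIntegrable _ _)]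
    rw [intervalIntegral.integral_congr (a := 0) (b := x) (g := fun _ => 0),
      intervalIntegral.integral_zero, zero_add]
    · congr 1
      rw [intervalIntegral.integral_congr (g := fun t => lowerGamma β (t - x))]
      · rw [integral_comp_sub_right (fun t => lowerGamma β t), sub_self]
      · intro t ht
        rw [uIcc_of_le hx.2] at ht
        simp only
        rw [max_eq_left (by linarith [ht.1])]
    · intro t ht
      rw [uIcc_of_le hx.1] at ht
      simp only
      rw [max_eq_right (by linarith [ht.2])]
      simp
  · exact (((continuous_corrConvKernel hβ).continuousOn
      (s := uIcc 0 T ×ˢ uIcc 0 T)).integrableOn_compact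
      (isCompact_uIcc.prod isCompact_uIcc)).mono_set
      (prod_mono uIoc_subset_uIcc uIoc_subset_uIcc)

lemma tendsto_integral_corrConv_sub (hβ : -1 < β) (hβ0 : β < 0) :
    Tendsto (fun T => (∫ t in (0:ℝ)..T, corrConv β t)
      - T * (Gamma (β + 1) * ∫ x in (0:ℝ)..T, exp (-x) * convDiff β x)) atTop
      (𝓝 (Gamma (β + 1) ^ 2 * ((β + 1) * (β + 1 / 2) - (1 / 4 - (β + 1) ^ 2 / 2)))) := by
  have hq := continuous_convDiff hβ
  have hh := continuous_lowerGammaPrim hβ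
  obtain ⟨C, hC⟩ := exists_bound_exp_neg_mul_convDiff hβ hβ0
  obtain ⟨D, hD⟩ := exists_bound_lowerGammaPrim_sub hβ hβ0
  have h1 := (((tendsto_integral_exp_neg_mul_convDiff hβ hβ0).const_mul
    (-(Gamma (β + 1) * (β + 1)))).sub
    ((tendsto_integral_mul_exp_neg_mul_convDiff hβ hβ0).const_mul (Gamma (β + 1)))).add
    (tendsto_convolution_of_exp_bound hC hD)
  have e : -(Gamma (β + 1) * (β + 1)) * -(Gamma (β + 1) * (β + 1 / 2)) -
        Gamma (β + 1) * (Gamma (β + 1) * (1 / 4 - (β + 1) ^ 2 / 2)) + 0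
      = Gamma (β + 1) ^ 2 * ((β + 1) * (β + 1 / 2) - (1 / 4 - (β + 1) ^ 2 / 2)) := by ring
  rw [e] at h1
  refine h1.congr' ?_
  filter_upwards [eventually_ge_atTop 0] with T hT
  rw [integral_corrConv hβ hT, ← mul_assoc]
  simp only [← intervalIntegral.integral_const_mul]
  have hi : ∀ f : ℝ → ℝ, Continuous f → IntervalIntegrable f volume 0 T :=
    fun f hf => hf.intervalIntegrable _ _
  rw [← intervalIntegral.integral_sub (hi _ (by fun_prop)) (hi _ (by fun_prop)),
    ← intervalIntegral.integral_add (hi _ (by fun_prop)) (hi _ (by fun_prop)),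
    ← intervalIntegral.integral_sub (hi _ (by fun_prop)) (hi _ (by fun_prop))]
  congr 1; ext x; ring

end Corrections

section Evaluation

variable {β : ℝ}

lemma lintegral_rpow_mul_exp_neg_mul_Ioi {a r : ℝ} (ha : 0 < a) (hr : 0 < r) :
    ∫⁻ t in Ioi (0:ℝ), ENNReal.ofReal (t ^ (a - 1) * exp (-(r * t))) =
      ENNReal.ofReal ((1 / r) ^ a * Gamma a) := by
  have h := integral_rpow_mul_exp_neg_mul_Ioi ha hr
  have hpos : 0 < (1 / r) ^ a * Gamma a := mul_pos (rpow_pos_of_pos (by positivity) _)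
    (Gamma_pos_of_pos ha)
  have hi : IntegrableOn (fun t : ℝ => t ^ (a - 1) * exp (-(r * t))) (Ioi 0) := by
    by_contra hc
    rw [integral_undef hc] at h
    linarith
  rw [← h, ofReal_integral_eq_lintegral_ofReal hi]
  filter_upwards [ae_restrict_mem measurableSet_Ioi] with t ht
  exact mul_nonneg (rpow_nonneg (le_of_lt ht) _) (exp_pos _).le

lemma lintegral_rpow_add_mul_exp_neg (hβ : -1 < β) (hβ0 : β < 0) {z : ℝ} (hz : 0 < z) :
    ∫⁻ w in Ioi (0:ℝ), ENNReal.ofReal ((z + w) ^ (β - 1) * (w * exp (-w))) =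
      ENNReal.ofReal (((z - β) * expTail β z - z ^ (β + 1)) / (-β)) := by
  have hβne : β ≠ 0 := hβ0.ne
  have hh := continuous_lowerGamma hβ
  set Ψ : ℝ → ℝ := fun w => exp z * (-β * lowerGamma β (z + w)
    + z * ((z + w) ^ β * exp (-(z + w)) + lowerGamma β (z + w))) / (-β) with hΨ
  have hd : ∀ w ∈ Ioi (0:ℝ), HasDerivAt Ψ ((z + w) ^ (β - 1) * (w * exp (-w))) w := by
    intro w hw
    have hw0 : 0 < w := hw
    have hp : 0 < z + w := by linarith
    have dx : HasDerivAt (fun w => z + w) 1 w := (hasDerivAt_id w).const_add z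
    have dg := (hasDerivAt_lowerGamma hβ hp).comp w dx
    have du := (hasDerivAt_rpow_const (p := β) (Or.inl hp.ne')).comp w dx
    have de := dx.neg.exp
    refine (((dg.const_mul (-β)).add (((du.mul de).add dg).const_mul z)).const_mul
      (exp z) |>.div_const (-β)).congr_deriv ?_
    have e1 : exp (-w) = exp z * exp (-(z + w)) := by rw [← exp_add]; ring_nf
    have e2 : (z + w) ^ β = (z + w) * (z + w) ^ (β - 1) := by
      rw [rpow_sub_one hp.ne']; field_simp
    simp only [Function.comp, Pi.neg_apply]
    rw [e1, e2]
    field_simp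
    ring
  have hc : ContinuousWithinAt Ψ (Ici 0) 0 := by
    have : ContinuousAt (fun w : ℝ => (z + w) ^ β) 0 :=
      (by fun_prop : ContinuousAt (fun w : ℝ => z + w) 0).rpow_const (Or.inl (by simpa using hz.ne'))
    have : ContinuousAt Ψ 0 := by
      simp only [hΨ]
      fun_prop
    exact this.continuousWithinAt
  have hnn : ∀ w ∈ Ioi (0:ℝ), 0 ≤ (z + w) ^ (β - 1) * (w * exp (-w)) := fun w hw =>
    mul_nonneg (rpow_nonneg (by linarith [mem_Ioi.1 hw]) _)
      (mul_nonneg (le_of_lt hw) (exp_pos _).le)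
  have hlim : Tendsto Ψ atTop (𝓝 (exp z * (-β * Gamma (β + 1) + z * (0 + Gamma (β + 1)))
      / (-β))) := by
    have hz' : Tendsto (fun w : ℝ => z + w) atTop atTop := tendsto_atTop_add_const_left _ _ tendsto_id
    have h1 := (tendsto_lowerGamma hβ).comp hz'
    have h2 := (tendsto_rpow_mul_exp_neg β).comp hz'
    exact (((h1.const_mul (-β)).add ((h2.add h1).const_mul z)).const_mul (exp z)).div_const (-β)
  have hi := integrableOn_Ioi_deriv_of_nonneg hc hd hnn hlim
  have hv := integral_Ioi_of_hasDerivAt_of_nonneg hc hd hnn hlim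
  rw [← ofReal_integral_eq_lintegral_ofReal hi
    ((ae_restrict_mem measurableSet_Ioi).mono hnn), hv]
  congr 1
  have e1 : exp z * exp (-z) = 1 := by rw [← exp_add]; simp
  simp only [hΨ, add_zero, rpow_add_one hz.ne', expTail]
  rw [← sub_div]
  congr 1
  linear_combination (- z * z ^ β) * e1

lemma lintegral_rpow_mul_expTail (hβ : -1 < β) (hβ0 : β < 0) :
    ENNReal.ofReal (Gamma (1 - β)) * ∫⁻ z in Ioi (0:ℝ), ENNReal.ofReal
      (z ^ β * (((z - β) * expTail β z - z ^ (β + 1)) / (-β))) =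
    ENNReal.ofReal (Gamma (β + 1) * Gamma (-(2 * β)) * Gamma (2 * β + 2)) := by
  set F : ℝ → ℝ → ℝ → ENNReal := fun z w s =>
    ENNReal.ofReal (z ^ β * (w * exp (-w)) * (s ^ (-β) * exp (-((z + w) * s)))) with hF
  have hFm : Measurable fun p : ℝ × ℝ × ℝ => F p.1 p.2.1 p.2.2 := by
    simp only [hF]; fun_prop
  have to_gamma : ENNReal.ofReal (Gamma (1 - β)) * ∫⁻ z in Ioi (0:ℝ), ENNReal.ofReal
      (z ^ β * (((z - β) * expTail β z - z ^ (β + 1)) / (-β))) =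
      ∫⁻ z in Ioi (0:ℝ), ∫⁻ w in Ioi (0:ℝ), ∫⁻ s in Ioi (0:ℝ), F z w s := by
    rw [← lintegral_const_mul' _ _ ENNReal.ofReal_ne_top]
    refine setLIntegral_congr_fun measurableSet_Ioi fun z hz => ?_
    have hz0 : 0 < z := hz
    have hzβ := rpow_nonneg hz0.le β
    simp only [hF]
    rw [ENNReal.ofReal_mul hzβ, ← lintegral_rpow_add_mul_exp_neg hβ hβ0 hz0, ← mul_assoc,
      ← lintegral_const_mul' _ _ (ENNReal.mul_ne_top ENNReal.ofReal_ne_top ENNReal.ofReal_ne_top)]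
    refine setLIntegral_congr_fun measurableSet_Ioi fun w hw => ?_
    have hw0 : 0 < w := hw
    have hG := (Gamma_pos_of_pos (by linarith : 0 < 1 - β)).le
    have hwe := mul_nonneg hw0.le (exp_pos (-w)).le
    have h1 : ∀ s : ℝ, ENNReal.ofReal (z ^ β * (w * exp (-w)) * (s ^ (-β) * exp (-((z + w) * s))))
        = ENNReal.ofReal (z ^ β * (w * exp (-w))) *
          ENNReal.ofReal (s ^ (1 - β - 1) * exp (-((z + w) * s))) := fun s => by
      rw [← ENNReal.ofReal_mul (mul_nonneg hzβ hwe)]; ring_nf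
    simp only [h1]
    rw [lintegral_const_mul' _ _ ENNReal.ofReal_ne_top,
      lintegral_rpow_mul_exp_neg_mul_Ioi (by linarith) (by linarith),
      ← ENNReal.ofReal_mul hG, ← ENNReal.ofReal_mul (mul_nonneg hG hzβ),
      ← ENNReal.ofReal_mul (mul_nonneg hzβ hwe)]
    congr 1
    rw [one_div, inv_rpow (by linarith), ← rpow_neg (by linarith), neg_sub]
    ring
  have fubini : ∫⁻ z in Ioi (0:ℝ), ∫⁻ w in Ioi (0:ℝ), ∫⁻ s in Ioi (0:ℝ), F z w s =
      ∫⁻ w in Ioi (0:ℝ), ∫⁻ s in Ioi (0:ℝ), ∫⁻ z in Ioi (0:ℝ), F z w s := by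
    rw [lintegral_lintegral_swap]
    · refine lintegral_congr fun w => ?_
      rw [lintegral_lintegral_swap]
      have : Measurable fun p : ℝ × ℝ => F p.1 w p.2 :=
        hFm.comp (by fun_prop : Measurable fun p : ℝ × ℝ => (p.1, w, p.2))
      exact this.aemeasurable
    · have : Measurable fun p : (ℝ × ℝ) × ℝ => F p.1.1 p.1.2 p.2 :=
        hFm.comp (by fun_prop : Measurable fun p : (ℝ × ℝ) × ℝ => (p.1.1, p.1.2, p.2))
      exact this.lintegral_prod_right'.aemeasurable
  have hG1 := (Gamma_pos_of_pos (by linarith : 0 < β + 1)).le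
  have hG2 := (Gamma_pos_of_pos (by linarith : 0 < -(2 * β))).le
  rw [to_gamma, fubini]
  have inner_eval : ∀ w ∈ Ioi (0:ℝ), ∫⁻ s in Ioi (0:ℝ), ∫⁻ z in Ioi (0:ℝ), F z w s =
      ENNReal.ofReal (Gamma (β + 1) * Gamma (-(2 * β))) *
        ENNReal.ofReal (w ^ (2 * β + 2 - 1) * exp (-(1 * w))) := by
    intro w hw
    have hw0 : 0 < w := hw
    have hwe := mul_nonneg hw0.le (exp_pos (-w)).le
    have inner : ∀ s ∈ Ioi (0:ℝ), ∫⁻ z in Ioi (0:ℝ), F z w s =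
        ENNReal.ofReal (w * exp (-w) * Gamma (β + 1)) *
          ENNReal.ofReal (s ^ (-(2 * β) - 1) * exp (-(w * s))) := by
      intro s hs
      have hs0 : 0 < s := hs
      have hnn : 0 ≤ w * exp (-w) * (s ^ (-β) * exp (-(w * s))) :=
        mul_nonneg hwe (mul_nonneg (rpow_nonneg hs0.le _) (exp_pos _).le)
      have h1 : ∀ z : ℝ, F z w s = ENNReal.ofReal (w * exp (-w) * (s ^ (-β) * exp (-(w * s)))) *
          ENNReal.ofReal (z ^ (β + 1 - 1) * exp (-(s * z))) := fun z => by
        rw [← ENNReal.ofReal_mul hnn]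
        simp only [hF]
        congr 1
        have : exp (-((z + w) * s)) = exp (-(w * s)) * exp (-(s * z)) := by
          rw [← exp_add]; ring_nf
        rw [this, add_sub_cancel_right]
        ring
      simp only [h1]
      rw [lintegral_const_mul' _ _ ENNReal.ofReal_ne_top,
        lintegral_rpow_mul_exp_neg_mul_Ioi (by linarith) hs0,
        ← ENNReal.ofReal_mul hnn, ← ENNReal.ofReal_mul (mul_nonneg hwe hG1)]
      congr 1
      have : s ^ (-(2 * β) - 1) = s ^ (-β) * (1 / s) ^ (β + 1) := by
        rw [one_div, inv_rpow hs0.le, ← rpow_neg hs0.le, ← rpow_add hs0]; ring_nf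
      rw [this]; ring
    rw [setLIntegral_congr_fun measurableSet_Ioi inner,
      lintegral_const_mul' _ _ ENNReal.ofReal_ne_top,
      lintegral_rpow_mul_exp_neg_mul_Ioi (by linarith) hw0,
      ← ENNReal.ofReal_mul (mul_nonneg hwe hG1), ← ENNReal.ofReal_mul (mul_nonneg hG1 hG2)]
    congr 1
    have : w ^ (2 * β + 2 - 1) = w * (1 / w) ^ (-(2 * β)) := by
      rw [one_div, inv_rpow hw0.le, ← rpow_neg hw0.le, neg_neg,
        show 2 * β + 2 - 1 = 2 * β + 1 by ring, rpow_add_one hw0.ne', mul_comm]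
    rw [this, one_mul]; ring
  rw [setLIntegral_congr_fun measurableSet_Ioi inner_eval,
    lintegral_const_mul' _ _ ENNReal.ofReal_ne_top,
    lintegral_rpow_mul_exp_neg_mul_Ioi (by linarith) one_pos,
    ← ENNReal.ofReal_mul (mul_nonneg hG1 hG2)]
  simp

lemma expTail_mul_sub_nonneg (hβ : -1 < β) (hβ0 : β < 0) {z : ℝ} (hz : 0 < z) :
    0 ≤ (z - β) * expTail β z - z ^ (β + 1) := by
  have hz1 : z ^ (β + 1) = z * z ^ β := by rw [rpow_add_one hz.ne', mul_comm]
  have hF : ∀ x, 0 < x → HasDerivAt (fun z => (Gamma (β + 1) - lowerGamma β z)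
      - exp (-z) * (z ^ (β + 1) / (z - β)))
      (-(exp (-x) * (x ^ β * (-β / (x - β) ^ 2)))) x := by
    intro x hx
    have hne : x - β ≠ 0 := by linarith
    refine (((hasDerivAt_lowerGamma hβ hx).const_sub _).sub (((hasDerivAt_neg x).exp).mul
      ((hasDerivAt_rpow_succ hx).div ((hasDerivAt_id x).sub_const β) hne))).congr_deriv ?_
    simp only [id, Pi.div_apply, rpow_add_one hx.ne']
    field_simp
    ring
  have hlim : Tendsto (fun z => (Gamma (β + 1) - lowerGamma β z)
      - exp (-z) * (z ^ (β + 1) / (z - β))) atTop (𝓝 0) := by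
    have h1 := (tendsto_lowerGamma hβ).const_sub (Gamma (β + 1))
    have h2 := (tendsto_rpow_mul_exp_neg (β + 1)).mul
      (tendsto_inv_atTop_zero.comp (tendsto_atTop_add_const_right atTop (-β) tendsto_id))
    have := h1.sub h2
    simp only [sub_self, mul_zero] at this
    refine this.congr fun z => ?_
    simp only [Function.comp, id, sub_eq_add_neg, div_eq_mul_inv]
    ring
  have key := nonneg_of_deriv_nonpos_of_tendsto_zero (a := 0) hF (fun x hx => by
    have h1 := rpow_nonneg hx.le β
    have h2 : 0 ≤ -β / (x - β) ^ 2 := div_nonneg (by linarith) (sq_nonneg _)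
    have := mul_nonneg (exp_pos (-x)).le (mul_nonneg h1 h2)
    linarith) hlim hz
  rw [Gamma_sub_lowerGamma, ← mul_sub] at key
  have h3 := (mul_nonneg_iff_of_pos_left (exp_pos (-z))).1 key
  have h4 : 0 < z - β := by linarith
  rw [sub_nonneg, div_le_iff₀ h4] at h3
  linarith

lemma tendsto_integral_expTail (hβ : -1 < β) (hβ0 : β < 0) :
    Tendsto (fun T => ∫ x in (0:ℝ)..T, ((x - β) * expTail β x - x ^ (β + 1)) * x ^ β) atTop
      (𝓝 (Gamma (β + 1) * Gamma (-(2 * β)) * Gamma (2 * β + 2) / Gamma (-β))) := by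
  have hβne : β ≠ 0 := hβ0.ne
  have hG := Gamma_pos_of_pos (by linarith : 0 < 1 - β)
  have hG0 := Gamma_pos_of_pos (by linarith : 0 < -β)
  have hG1 := Gamma_pos_of_pos (by linarith : 0 < β + 1)
  have hG2 := Gamma_pos_of_pos (by linarith : 0 < -(2 * β))
  have hG3 := Gamma_pos_of_pos (by linarith : 0 < 2 * β + 2)
  have hGrec : Gamma (1 - β) = -β * Gamma (-β) := by
    rw [← Gamma_add_one (by linarith : -β ≠ 0)]; ring_nf
  have hnn : ∀ z ∈ Ioi (0:ℝ), 0 ≤ ((z - β) * expTail β z - z ^ (β + 1)) * z ^ β := fun z hz =>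
    mul_nonneg (expTail_mul_sub_nonneg hβ hβ0 hz) (rpow_nonneg (le_of_lt hz) _)
  have hm : AEStronglyMeasurable (fun z => ((z - β) * expTail β z - z ^ (β + 1)) * z ^ β)
      (volume.restrict (Ioi 0)) := by
    have := continuous_expTail hβ
    exact (by fun_prop : Measurable _).aestronglyMeasurable
  have hl : ∫⁻ z in Ioi (0:ℝ), ENNReal.ofReal (((z - β) * expTail β z - z ^ (β + 1)) * z ^ β) =
      ENNReal.ofReal (Gamma (β + 1) * Gamma (-(2 * β)) * Gamma (2 * β + 2) / Gamma (-β)) := by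
    have h1 := lintegral_rpow_mul_expTail hβ hβ0
    have h2 : ∀ z ∈ Ioi (0:ℝ), ENNReal.ofReal (((z - β) * expTail β z - z ^ (β + 1)) * z ^ β) =
        ENNReal.ofReal (-β) * ENNReal.ofReal
          (z ^ β * (((z - β) * expTail β z - z ^ (β + 1)) / (-β))) := fun z _ => by
      rw [← ENNReal.ofReal_mul (by linarith)]
      congr 1
      field_simp
    rw [setLIntegral_congr_fun measurableSet_Ioi h2,
      lintegral_const_mul' _ _ ENNReal.ofReal_ne_top]
    have h3 : ENNReal.ofReal (-β) = ENNReal.ofReal (1 / Gamma (-β)) *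
        ENNReal.ofReal (Gamma (1 - β)) := by
      rw [← ENNReal.ofReal_mul (by positivity), hGrec]
      congr 1
      field_simp
    rw [h3, mul_assoc, h1, ← ENNReal.ofReal_mul (by positivity)]
    congr 1
    ring
  have hi : IntegrableOn (fun z => ((z - β) * expTail β z - z ^ (β + 1)) * z ^ β) (Ioi 0) := by
    refine ⟨hm, ?_⟩
    rw [hasFiniteIntegral_iff_ofReal ((ae_restrict_mem measurableSet_Ioi).mono hnn), hl]
    exact ENNReal.ofReal_lt_top
  have hv : ∫ z in Ioi (0:ℝ), ((z - β) * expTail β z - z ^ (β + 1)) * z ^ β =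
      Gamma (β + 1) * Gamma (-(2 * β)) * Gamma (2 * β + 2) / Gamma (-β) := by
    rw [integral_eq_lintegral_of_nonneg_ae ((ae_restrict_mem measurableSet_Ioi).mono hnn) hm, hl,
      ENNReal.toReal_ofReal (by positivity)]
  rw [← hv]
  exact intervalIntegral_tendsto_integral_Ioi 0 hi tendsto_id

lemma tendsto_sqInt (hβ : -1 < β) (hβ0 : β < 0) :
    Tendsto (sqInt β) atTop (𝓝 (2 * (Gamma (β + 1) * Gamma (-(2 * β)) * Gamma (2 * β + 2)
      / Gamma (-β)) - 1 / 2 * Gamma (β + 1) ^ 2)) := by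
  have h := (tendsto_sqInt_sub hβ hβ0).add ((tendsto_integral_expTail hβ hβ0).const_mul 2)
  simp only [sub_add_cancel] at h
  convert h using 2
  ring

end Evaluation

lemma Gamma_ratio_eq_sigmaH2 {H : ℝ} (hH : H ∈ Ioo (0:ℝ) (1/2)) :
    2 * (Gamma (2 * H) * Gamma (-(2 * (2 * H - 1))) * Gamma (2 * (2 * H - 1) + 2)
      / Gamma (-(2 * H - 1))) = Gamma (2 * H) ^ 2 * (sigmaH2 H - (4 * H - 1)) := by
  obtain ⟨h0, h1⟩ := hH
  have hG0 := Gamma_pos_of_pos (by linarith : 0 < -(2 * H - 1))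
  have hG1 := Gamma_pos_of_pos (by linarith : 0 < 2 * H)
  rw [sigmaH2]
  split_ifs with h
  · subst h
    norm_num
    rw [Gamma_one_half_eq, sq_sqrt pi_pos.le]
    field_simp
  · have hs : 0 < sin (π * (2 * H)) :=
      sin_pos_of_pos_of_lt_pi (by positivity) (by nlinarith [pi_pos])
    have r1 := Gamma_mul_Gamma_one_sub (2 * H)
    have r2 := Gamma_mul_Gamma_one_sub (4 * H - 1)
    have r3 : Gamma (2 * (2 * H - 1) + 2) = (4 * H - 1) * Gamma (4 * H - 1) := by
      rw [← Gamma_add_one (by intro hc; apply h; linarith)]; ring_nf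
    have e1 : 1 - 2 * H = -(2 * H - 1) := by ring
    have e2 : 1 - (4 * H - 1) = -(2 * (2 * H - 1)) := by ring
    have e3 : sin (π * (4 * H - 1)) = -(2 * sin (π * (2 * H)) * cos (2 * H * π)) := by
      rw [show π * (4 * H - 1) = 2 * (π * (2 * H)) - π by ring, sin_sub_pi, sin_two_mul,
        mul_comm (2 * H) π]
    rw [e1] at r1
    rw [e2, e3] at r2
    have hc : cos (2 * H * π) ≠ 0 := by
      intro hc
      have : 2 * H * π = π / 2 := by
        refine injOn_cos ⟨by positivity, by nlinarith [pi_pos]⟩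
          ⟨by positivity, by linarith [pi_pos]⟩ ?_
        rw [hc, cos_pi_div_two]
      apply h
      have hp := pi_ne_zero
      have : (2 * H) * π = (1 / 2) * π := by linarith
      have := mul_right_cancel₀ hp this
      linarith
    have r5 : Gamma (2 * H) * Gamma (-(2 * (2 * H - 1))) * Gamma (2 * (2 * H - 1) + 2) =
        Gamma (2 * H) * (4 * H - 1) * (π / -(2 * sin (π * (2 * H)) * cos (2 * H * π))) := by
      rw [r3, ← r2]; ring
    rw [r5]
    have hp := pi_ne_zero
    generalize Gamma (-(2 * H - 1)) = g at *
    generalize Gamma (2 * H) = k at *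
    generalize sin (π * (2 * H)) = s at *
    generalize cos (2 * H * π) = c at *
    rw [eq_div_iff hs.ne'] at r1
    rw [← r1]
    have := hs.ne'
    field_simp
    ring

/-- The odd kernel `sgn(x)|x|^β`. -/
noncomputable def signedRpow (β x : ℝ) : ℝ := Real.sign x * |x| ^ β

/-- The odd kernel `sgn(x)e^{-|x|}`. -/
noncomputable def signedExp (x : ℝ) : ℝ := Real.sign x * exp (-|x|)

section Kernels

variable {β : ℝ}

lemma signedRpow_of_pos {x : ℝ} (hx : 0 < x) : signedRpow β x = x ^ β := by
  rw [signedRpow, Real.sign_of_pos hx, abs_of_pos hx, one_mul]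

lemma signedRpow_neg (x : ℝ) : signedRpow β (-x) = -signedRpow β x := by
  rw [signedRpow, signedRpow, Real.sign_neg, abs_neg, neg_mul]

lemma signedExp_of_pos {x : ℝ} (hx : 0 < x) : signedExp x = exp (-x) := by
  rw [signedExp, Real.sign_of_pos hx, abs_of_pos hx, one_mul]

lemma signedExp_neg (x : ℝ) : signedExp (-x) = -signedExp x := by
  rw [signedExp, signedExp, Real.sign_neg, abs_neg, neg_mul]

lemma measurable_sign : Measurable Real.sign := by
  unfold Real.sign
  exact Measurable.ite measurableSet_Iio measurable_const
    (Measurable.ite measurableSet_Ioi measurable_const measurable_const)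

@[fun_prop]
lemma measurable_signedRpow : Measurable (signedRpow β) :=
  measurable_sign.mul (by fun_prop)

@[fun_prop]
lemma measurable_signedExp : Measurable signedExp :=
  measurable_sign.mul (by fun_prop)

lemma abs_sign_le_one (x : ℝ) : |Real.sign x| ≤ 1 := by
  rcases Real.sign_apply_eq x with h | h | h <;> simp [h]

lemma abs_signedRpow_le (x : ℝ) : |signedRpow β x| ≤ |x| ^ β := by
  rw [signedRpow, abs_mul, abs_of_nonneg (rpow_nonneg (abs_nonneg x) β)]
  exact mul_le_of_le_one_left (rpow_nonneg (abs_nonneg x) β) (abs_sign_le_one x)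

lemma abs_signedExp_le (x : ℝ) : |signedExp x| ≤ 1 := by
  rw [signedExp, abs_mul, abs_of_pos (exp_pos _)]
  exact mul_le_one₀ (abs_sign_le_one x) (exp_pos _).le (exp_le_one_iff.2 (by simp))

/-- The triple integral to which both `I1` and `I2` reduce. -/
noncomputable def pairInt (β T : ℝ) : ℝ :=
  ∫ z in (0:ℝ)..T, (∫ x in (0:ℝ)..T, exp (-x) * signedRpow β (z - x)) *
    ∫ y in (0:ℝ)..T, y ^ β * signedExp (z - y)

lemma integral_exp_neg_mul_signedRpow (hβ : -1 < β) {z T : ℝ} (hz : z ∈ Icc 0 T) :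
    ∫ x in (0:ℝ)..T, exp (-x) * signedRpow β (z - x) =
      expConv β z - exp (-z) * lowerGamma β (T - z) := by
  obtain ⟨h0, h1⟩ := hz
  have eql : EqOn (fun x => exp (-x) * signedRpow β (z - x))
      (fun x => exp (-z) * (exp (z - x) * (z - x) ^ β)) (uIoo 0 z) := fun x hx => by
    rw [uIoo_of_le h0] at hx
    simp only
    rw [signedRpow_of_pos (by linarith [hx.2]), ← mul_assoc, ← exp_add]
    ring_nf
  have eqr : EqOn (fun x => exp (-x) * signedRpow β (z - x))
      (fun x => -exp (-z) * (exp (-(x - z)) * (x - z) ^ β)) (uIoo z T) := fun x hx => by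
    rw [uIoo_of_le h1] at hx
    simp only
    rw [← neg_sub x z, signedRpow_neg, signedRpow_of_pos (by linarith [hx.1]), neg_mul,
      ← mul_assoc, ← exp_add]
    ring_nf
  have il : IntervalIntegrable (fun x => exp (z - x) * (z - x) ^ β) volume 0 z := by
    have := (intervalIntegrable_continuous_mul_rpow hβ (f := exp) (a := z) (b := 0)
      (by fun_prop)).comp_sub_left z
    simpa using this
  have ir : IntervalIntegrable (fun x => exp (-(x - z)) * (x - z) ^ β) volume z T := by
    have := (intervalIntegrable_continuous_mul_rpow hβ (f := fun x => exp (-x)) (a := 0)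
      (b := T - z) (by fun_prop)).comp_sub_right z
    simpa using this
  rw [← integral_add_adjacent_intervals (b := z) ((il.const_mul _).congr_uIoo eql.symm)
    ((ir.const_mul _).congr_uIoo eqr.symm), integral_congr_uIoo eql, integral_congr_uIoo eqr,
    intervalIntegral.integral_const_mul, intervalIntegral.integral_const_mul,
    integral_comp_sub_left (fun x => exp x * x ^ β),
    integral_comp_sub_right (fun x => exp (-x) * x ^ β), expConv, lowerGamma]
  simp only [sub_self, sub_zero]
  ring

lemma integral_rpow_mul_signedExp (hβ : -1 < β) {z T : ℝ} (hz : z ∈ Icc 0 T) :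
    ∫ y in (0:ℝ)..T, y ^ β * signedExp (z - y) =
      convDiff β z + exp (z - T) * expTail β T := by
  obtain ⟨h0, h1⟩ := hz
  have eql : EqOn (fun y => y ^ β * signedExp (z - y))
      (fun y => exp (-z) * (exp y * y ^ β)) (uIoo 0 z) := fun x hx => by
    rw [uIoo_of_le h0] at hx
    simp only
    rw [signedExp_of_pos (by linarith [hx.2]), ← mul_assoc, ← exp_add]
    ring_nf
  have eqr : EqOn (fun y => y ^ β * signedExp (z - y))
      (fun y => -exp z * (exp (-y) * y ^ β)) (uIoo z T) := fun x hx => by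
    rw [uIoo_of_le h1] at hx
    simp only
    rw [← neg_sub x z, signedExp_neg, signedExp_of_pos (by linarith [hx.1]), neg_mul,
      ← mul_assoc, ← exp_add]
    ring_nf
  have i1 : ∀ a b, IntervalIntegrable (fun x => exp x * x ^ β) volume a b := fun a b =>
    intervalIntegrable_continuous_mul_rpow hβ (by fun_prop)
  have i2 : ∀ a b, IntervalIntegrable (fun x => exp (-x) * x ^ β) volume a b := fun a b =>
    intervalIntegrable_continuous_mul_rpow hβ (by fun_prop)
  rw [← integral_add_adjacent_intervals (b := z) (((i1 0 z).const_mul _).congr_uIoo eql.symm)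
    (((i2 z T).const_mul _).congr_uIoo eqr.symm), integral_congr_uIoo eql, integral_congr_uIoo eqr,
    intervalIntegral.integral_const_mul, intervalIntegral.integral_const_mul,
    ← integral_interval_sub_left (i2 0 T) (i2 0 z)]
  have e : exp (z - T) * exp T = exp z := by rw [← exp_add]; ring_nf
  rw [convDiff, expConv, expTail, expTail, ← mul_assoc, e, lowerGamma, lowerGamma]
  ring

lemma pairInt_eq (hβ : -1 < β) {T : ℝ} (hT : 0 ≤ T) :
    pairInt β T = mainPart β T - corrConv β T -
      (Gamma (β + 1) - lowerGamma β T) * lowerGammaPrim β T := by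
  have hg := continuous_expConv hβ
  have hq := continuous_convDiff hβ
  have hl := continuous_lowerGamma hβ
  have e : EqOn (fun z => (∫ x in (0:ℝ)..T, exp (-x) * signedRpow β (z - x)) *
      ∫ y in (0:ℝ)..T, y ^ β * signedExp (z - y))
      (fun z => expConv β z * convDiff β z + exp (-T) * expTail β T * (exp z * expConv β z)
        - exp (-z) * convDiff β z * lowerGamma β (T - z)
        - exp (-T) * expTail β T * lowerGamma β (T - z)) (uIcc 0 T) := fun z hz => by
    rw [uIcc_of_le hT] at hz
    simp only
    rw [integral_exp_neg_mul_signedRpow hβ hz, integral_rpow_mul_signedExp hβ hz, sub_eq_add_neg z T,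
      exp_add]
    have : exp (-z) * exp z = 1 := by rw [← exp_add]; simp
    linear_combination (-lowerGamma β (T - z) * exp (-T) * expTail β T) * this
  have ii : ∀ {f : ℝ → ℝ}, Continuous f → IntervalIntegrable f volume 0 T :=
    fun h => h.intervalIntegrable _ _
  rw [pairInt, intervalIntegral.integral_congr e, intervalIntegral.integral_sub (ii (by fun_prop))
      (ii (by fun_prop)), intervalIntegral.integral_sub (ii (by fun_prop)) (ii (by fun_prop)),
    intervalIntegral.integral_add (ii (by fun_prop)) (ii (by fun_prop)),
    intervalIntegral.integral_const_mul, intervalIntegral.integral_const_mul,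
    integral_comp_sub_left (lowerGamma β), sub_self, sub_zero, integral_lowerGamma hβ hT,
    integral_expConv_mul_convDiff hβ hT, integral_exp_mul_expConv hβ hT, Gamma_sub_lowerGamma,
    mainPart, corrConv]
  have : exp (-T) * exp T = 1 := by rw [← exp_add]; simp
  linear_combination (expTail β T * ((T + β + 1) * expConv β T - T ^ (β + 1))) * this

lemma integral_pairInt (hβ : -1 < β) {T : ℝ} (hT : 0 ≤ T) :
    ∫ t in (0:ℝ)..T, pairInt β t = (∫ t in (0:ℝ)..T, mainPart β t) -
      (∫ t in (0:ℝ)..T, corrConv β t) -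
      ∫ t in (0:ℝ)..T, (Gamma (β + 1) - lowerGamma β t) * lowerGammaPrim β t := by
  have hl := continuous_lowerGamma hβ
  have hL := continuous_lowerGammaPrim hβ
  have hm := (continuous_mainPart hβ).intervalIntegrable (μ := volume) 0 T
  have hc := intervalIntegrable_corrConv hβ hT
  rw [← intervalIntegral.integral_sub hm hc, ← intervalIntegral.integral_sub (hm.sub hc)
    ((by fun_prop : Continuous _).intervalIntegrable _ _)]
  refine intervalIntegral.integral_congr fun t ht => ?_
  rw [uIcc_of_le hT] at ht
  exact pairInt_eq hβ ht.1

end Kernels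
lemma I2_eq_pairInt (H T : ℝ) : I2 H T = 2 * pairInt (2 * H - 1) T := by
  rw [I2, pairInt]
  congr 2
  ext z
  rw [← intervalIntegral.integral_mul_const]
  congr 1
  ext x
  rw [← intervalIntegral.integral_const_mul]
  congr 1
  ext y
  rw [sub_eq_add_neg (-|z - y|) x, exp_add, ← neg_sub z y, ← neg_sub z x, Real.sign_neg,
    Real.sign_neg, abs_neg, signedRpow, signedExp]
  ring

section FourFold

variable {β : ℝ}

lemma intervalIntegrable_abs_rpow (hβ : -1 < β) (a b : ℝ) :
    IntervalIntegrable (fun x : ℝ => |x| ^ β) volume a b := by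
  refine intervalIntegrable_of_even (fun x => by rw [abs_neg]) fun x hx => ?_
  refine (intervalIntegrable_rpow' hβ).congr fun y hy => ?_
  rw [uIoc_of_le hx.le] at hy
  rw [abs_of_pos hy.1]

lemma integrable_abs_sub_rpow (hβ : -1 < β) (T : ℝ) :
    Integrable (fun p : ℝ × ℝ => |p.1 - p.2| ^ β)
      ((volume.restrict (Ioc 0 T)).prod (volume.restrict (Ioc 0 T))) := by
  have hk : IntegrableOn (fun x : ℝ => |x| ^ β) (Icc (-T) T) :=
    (integrableOn_Icc_iff_integrableOn_Ioc (by simp)).2 (intervalIntegrable_abs_rpow hβ _ _).1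
  have h1 : Integrable ((Ioc 0 T).indicator (fun _ : ℝ => (1:ℝ))) :=
    (integrable_indicator_iff measurableSet_Ioc).2 (by simp)
  have := h1.convolution_integrand (ContinuousLinearMap.mul ℝ ℝ)
    ((integrable_indicator_iff measurableSet_Icc).2 hk)
  rw [Measure.prod_restrict]
  refine this.integrableOn.congr_fun (fun p hp => ?_) (measurableSet_Ioc.prod measurableSet_Ioc)
  obtain ⟨hp1, hp2⟩ := hp
  simp only [ContinuousLinearMap.mul_apply']
  rw [indicator_of_mem hp2, indicator_of_mem, one_mul]
  exact ⟨by linarith [hp1.1, hp2.2], by linarith [hp1.2, hp2.1]⟩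

/-- The integrand of `I1`, as a function of `((t₁, t₂), (s₁, s₂))`. -/
noncomputable def quadKernel (β : ℝ) (q : (ℝ × ℝ) × (ℝ × ℝ)) : ℝ :=
  signedExp (q.1.1 - q.2.1) * signedExp (q.1.2 - q.2.2) * signedRpow β (q.1.1 - q.1.2) *
    signedRpow β (q.2.1 - q.2.2)

lemma measurable_quadKernel : Measurable (quadKernel β) := by
  unfold quadKernel
  fun_prop

lemma abs_quadKernel_le (q : (ℝ × ℝ) × (ℝ × ℝ)) :
    |quadKernel β q| ≤ |q.1.1 - q.1.2| ^ β * |q.2.1 - q.2.2| ^ β := by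
  rw [quadKernel, abs_mul, abs_mul, abs_mul]
  refine mul_le_mul ?_ (abs_signedRpow_le _) (abs_nonneg _) (rpow_nonneg (abs_nonneg _) _)
  refine (mul_le_of_le_one_left (abs_nonneg _) ?_).trans (abs_signedRpow_le _)
  exact mul_le_one₀ (abs_signedExp_le _) (abs_nonneg _) (abs_signedExp_le _)

lemma integrable_quadKernel (hβ : -1 < β) (T : ℝ) :
    Integrable (quadKernel β)
      (((volume.restrict (Ioc 0 T)).prod (volume.restrict (Ioc 0 T))).prod
        ((volume.restrict (Ioc 0 T)).prod (volume.restrict (Ioc 0 T)))) :=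
  ((integrable_abs_sub_rpow hβ T).mul_prod (integrable_abs_sub_rpow hβ T)).mono'
    measurable_quadKernel.aestronglyMeasurable (Eventually.of_forall abs_quadKernel_le)

lemma quadKernel_swap (q : (ℝ × ℝ) × (ℝ × ℝ)) : quadKernel β q.swap = quadKernel β q := by
  simp only [quadKernel, Prod.fst_swap, Prod.snd_swap]
  rw [← neg_sub q.1.1, ← neg_sub q.1.2, signedExp_neg, signedExp_neg]
  ring

lemma quadKernel_map_swap (q : (ℝ × ℝ) × (ℝ × ℝ)) :
    quadKernel β (q.1.swap, q.2.swap) = quadKernel β q := by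
  simp only [quadKernel, Prod.fst_swap, Prod.snd_swap]
  rw [← neg_sub q.1.1 q.1.2, ← neg_sub q.2.1 q.2.2, signedRpow_neg, signedRpow_neg]
  ring

lemma ae_fst_fst_ne_snd_snd {μ : Measure ℝ} [SFinite μ] [NullSingletonClass μ] :
    ∀ᵐ q ∂((μ.prod μ).prod (μ.prod μ)), q.1.1 ≠ q.2.2 := by
  have hm : MeasurableSet {q : (ℝ × ℝ) × (ℝ × ℝ) | q.1.1 = q.2.2} :=
    measurableSet_eq_fun (by fun_prop) (by fun_prop)
  rw [ae_iff]
  simp only [ne_eq, not_not]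
  rw [Measure.measure_prod_null hm]
  refine Eventually.of_forall fun p => ?_
  have : Prod.mk p ⁻¹' {q : (ℝ × ℝ) × (ℝ × ℝ) | q.1.1 = q.2.2} =
      (Prod.snd : ℝ × ℝ → ℝ) ⁻¹' {p.1} := by
    ext r; simp [eq_comm]
  simp only [this, Pi.zero_apply]
  exact Measure.quasiMeasurePreserving_snd.preimage_null (measure_singleton _)

/-- The set on which the first coordinate is the largest. -/
def maxFirst : Set ((ℝ × ℝ) × (ℝ × ℝ)) :=
  {q | q.1.2 ≤ q.1.1 ∧ q.2.1 ≤ q.1.1 ∧ q.2.2 ≤ q.1.1}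

lemma measurableSet_maxFirst : MeasurableSet maxFirst :=
  (measurableSet_le measurable_fst.snd measurable_fst.fst).inter
    ((measurableSet_le measurable_snd.fst measurable_fst.fst).inter
      (measurableSet_le measurable_snd.snd measurable_fst.fst))

lemma integral_quadKernel_eq (hβ : -1 < β) (T : ℝ) :
    ∫ q, quadKernel β q ∂(((volume.restrict (Ioc 0 T)).prod (volume.restrict (Ioc 0 T))).prod
        ((volume.restrict (Ioc 0 T)).prod (volume.restrict (Ioc 0 T)))) =
      4 * ∫ q, maxFirst.indicator (quadKernel β) q
        ∂(((volume.restrict (Ioc 0 T)).prod (volume.restrict (Ioc 0 T))).prod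
        ((volume.restrict (Ioc 0 T)).prod (volume.restrict (Ioc 0 T)))) := by
  set ν : Measure ℝ := volume.restrict (Ioc 0 T)
  have hF : Integrable (maxFirst.indicator (quadKernel β)) ((ν.prod ν).prod (ν.prod ν)) :=
    (integrable_quadKernel hβ T).indicator measurableSet_maxFirst
  let τ : (ℝ × ℝ) × (ℝ × ℝ) ≃ᵐ (ℝ × ℝ) × (ℝ × ℝ) := MeasurableEquiv.prodComm
  let σ : (ℝ × ℝ) × (ℝ × ℝ) ≃ᵐ (ℝ × ℝ) × (ℝ × ℝ) :=
    MeasurableEquiv.prodCongr MeasurableEquiv.prodComm MeasurableEquiv.prodComm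
  have hτ : MeasurePreserving τ ((ν.prod ν).prod (ν.prod ν)) ((ν.prod ν).prod (ν.prod ν)) :=
    Measure.measurePreserving_swap
  have hσ : MeasurePreserving σ ((ν.prod ν).prod (ν.prod ν)) ((ν.prod ν).prod (ν.prod ν)) :=
    Measure.measurePreserving_swap.prod Measure.measurePreserving_swap
  set G := maxFirst.indicator (quadKernel β) with hG
  have i1 := (hτ.integrable_comp_emb τ.measurableEmbedding).2 hF
  have i2 := (hσ.integrable_comp_emb σ.measurableEmbedding).2 hF
  have i3 := ((hσ.comp hτ).integrable_comp_emb
    (σ.measurableEmbedding.comp τ.measurableEmbedding)).2 hF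
  have e1 := hτ.integral_comp τ.measurableEmbedding G
  have e2 := hσ.integral_comp σ.measurableEmbedding G
  have e3 := (hσ.comp hτ).integral_comp (σ.measurableEmbedding.comp τ.measurableEmbedding) G
  have hsum : ∫ q, quadKernel β q ∂((ν.prod ν).prod (ν.prod ν)) =
      ∫ q, (G q + G (τ q)) + (G (σ q) + G ((σ ∘ τ) q)) ∂((ν.prod ν).prod (ν.prod ν)) := by
    have h1 := ae_fst_fst_ne_snd_snd (μ := ν)
    have h2 := hσ.quasiMeasurePreserving.ae h1
    refine integral_congr_ae ?_
    filter_upwards [h1, h2] with q h1 h2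
    have k1 : quadKernel β (τ q) = quadKernel β q := quadKernel_swap q
    have k2 : quadKernel β (σ q) = quadKernel β q := quadKernel_map_swap q
    have k3 : quadKernel β ((σ ∘ τ) q) = quadKernel β q :=
      (quadKernel_map_swap q.swap).trans (quadKernel_swap q)
    classical
    simp only [hG, indicator_apply, k1, k2, k3]
    obtain ⟨⟨a, b⟩, ⟨c, d⟩⟩ := q
    change a ≠ d at h1
    change b ≠ c at h2
    by_cases h0 : quadKernel β ((a, b), (c, d)) = 0
    · simp [h0]
    have n1 : a ≠ c := by rintro rfl; simp [quadKernel, signedExp] at h0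
    have n2 : b ≠ d := by rintro rfl; simp [quadKernel, signedExp] at h0
    have n3 : a ≠ b := by rintro rfl; simp [quadKernel, signedRpow] at h0
    have n4 : c ≠ d := by rintro rfl; simp [quadKernel, signedRpow] at h0
    have m0 : ((a, b), (c, d)) ∈ maxFirst ↔ b ≤ a ∧ c ≤ a ∧ d ≤ a := Iff.rfl
    have m1 : τ ((a, b), (c, d)) ∈ maxFirst ↔ d ≤ c ∧ a ≤ c ∧ b ≤ c := Iff.rfl
    have m2 : σ ((a, b), (c, d)) ∈ maxFirst ↔ a ≤ b ∧ d ≤ b ∧ c ≤ b := Iff.rfl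
    have m3 : (σ ∘ τ) ((a, b), (c, d)) ∈ maxFirst ↔ c ≤ d ∧ b ≤ d ∧ a ≤ d := Iff.rfl
    simp only [m0, m1, m2, m3]
    grind
  have s1 := integral_add hF i1
  have s2 := integral_add i2 i3
  have s3 := integral_add (hF.add i1) (i2.add i3)
  simp only [Function.comp_apply, Pi.add_apply] at s1 s2 s3 e3
  simp only [Function.comp_apply] at hsum
  rw [hsum, s3, s1, s2, e1, e2, e3]
  ring

lemma measurePreserving_sub_left_Ioc (t : ℝ) :
    MeasurePreserving (MeasurableEquiv.subLeft t) (volume.restrict (Ioc 0 t))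
      (volume.restrict (Ioc 0 t)) := by
  have h := (Measure.measurePreserving_sub_left (volume : Measure ℝ) t).restrict_preimage
    (s := Ioc 0 t) measurableSet_Ioc
  rw [preimage_const_sub_Ioc, sub_self, sub_zero,
    Measure.restrict_congr_set Ico_ae_eq_Ioc] at h
  exact h

lemma pairInt_eq_integral_prod (hβ : -1 < β) {t : ℝ} (ht : 0 ≤ t) :
    ∫ p, quadKernel β ((t, p.1), p.2) ∂((volume.restrict (Ioc 0 t)).prod
      ((volume.restrict (Ioc 0 t)).prod (volume.restrict (Ioc 0 t)))) = pairInt β t := by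
  set ν : Measure ℝ := volume.restrict (Ioc 0 t)
  have hφ := measurePreserving_sub_left_Ioc t
  set Φ : ℝ × ℝ × ℝ ≃ᵐ ℝ × ℝ × ℝ := (MeasurableEquiv.subLeft t).prodCongr
    ((MeasurableEquiv.subLeft t).prodCongr (MeasurableEquiv.subLeft t))
  have hΦ : MeasurePreserving Φ (ν.prod (ν.prod ν)) (ν.prod (ν.prod ν)) := hφ.prod (hφ.prod hφ)
  set f : ℝ × ℝ × ℝ → ℝ := fun p => (signedExp p.2.1 * signedRpow β (p.2.2 - p.2.1)) *
    (signedRpow β p.1 * signedExp (p.2.2 - p.1)) with hf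
  have hcomp : ∀ p : ℝ × ℝ × ℝ, quadKernel β ((t, p.1), p.2) = f (Φ p) := fun p => by
    change _ = (signedExp (t - p.2.1) * signedRpow β ((t - p.2.2) - (t - p.2.1))) *
      (signedRpow β (t - p.1) * signedExp ((t - p.2.2) - (t - p.1)))
    simp only [quadKernel, sub_sub_sub_cancel_left]
    ring
  have hint : Integrable f (ν.prod (ν.prod ν)) := by
    have hr : Integrable (fun y : ℝ => |y| ^ β) ν := (intervalIntegrable_abs_rpow hβ 0 t).1
    refine (hr.mul_prod (integrable_abs_sub_rpow hβ t)).mono' ?_ (Eventually.of_forall fun p => ?_)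
    · exact (by simp only [hf]; fun_prop : Measurable f).aestronglyMeasurable
    · rw [norm_eq_abs, hf, abs_mul, abs_mul, abs_mul, abs_sub_comm p.2.1]
      have a1 := mul_le_mul (abs_signedExp_le p.2.1) (abs_signedRpow_le (β := β) (p.2.2 - p.2.1))
        (abs_nonneg _) zero_le_one
      have a2 := mul_le_mul (abs_signedRpow_le (β := β) p.1) (abs_signedExp_le (p.2.2 - p.1))
        (abs_nonneg _) (rpow_nonneg (abs_nonneg _) _)
      have := mul_le_mul a1 a2 (by positivity) (by positivity)
      linarith
  rw [integral_congr_ae (Eventually.of_forall hcomp), hΦ.integral_comp Φ.measurableEmbedding,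
    integral_prod_symm _ hint, integral_prod_symm _ hint.integral_prod_right, pairInt,
    intervalIntegral.integral_of_le ht]
  refine integral_congr_ae (Eventually.of_forall fun z => ?_)
  simp only [hf, MeasureTheory.integral_const_mul, MeasureTheory.integral_mul_const]
  rw [← intervalIntegral.integral_of_le ht, ← intervalIntegral.integral_of_le ht]
  congr 1
  · refine integral_congr_uIoo fun x hx => ?_
    rw [uIoo_of_le ht] at hx
    rw [signedExp_of_pos hx.1]
  · refine integral_congr_uIoo fun x hx => ?_
    rw [uIoo_of_le ht] at hx
    rw [signedRpow_of_pos hx.1]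

lemma integral_quadKernel_eq_pairInt (hβ : -1 < β) {T : ℝ} (hT : 0 ≤ T) :
    ∫ q, quadKernel β q ∂(((volume.restrict (Ioc 0 T)).prod (volume.restrict (Ioc 0 T))).prod
        ((volume.restrict (Ioc 0 T)).prod (volume.restrict (Ioc 0 T)))) =
      4 * ∫ t in (0:ℝ)..T, pairInt β t := by
  rw [integral_quadKernel_eq hβ, intervalIntegral.integral_of_le hT]
  congr 1
  set ν : Measure ℝ := volume.restrict (Ioc 0 T) with hν
  have hF : Integrable (maxFirst.indicator (quadKernel β)) ((ν.prod ν).prod (ν.prod ν)) :=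
    (integrable_quadKernel hβ T).indicator measurableSet_maxFirst
  have hF' := (measurePreserving_prodAssoc ν ν (ν.prod ν)).symm.integrable_comp_emb
    (MeasurableEquiv.measurableEmbedding _) |>.2 hF
  rw [← (measurePreserving_prodAssoc ν ν (ν.prod ν)).symm.integral_comp
    (MeasurableEquiv.measurableEmbedding _)]
  refine (integral_prod _ hF').trans ?_
  refine setIntegral_congr_fun measurableSet_Ioc fun t ht => ?_
  have hS : ∀ p : ℝ × ℝ × ℝ, maxFirst.indicator (quadKernel β)
      (MeasurableEquiv.prodAssoc.symm (t, p)) =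
      (Iic t ×ˢ (Iic t ×ˢ Iic t)).indicator (fun p => quadKernel β ((t, p.1), p.2)) p := fun p => rfl
  have hm := (measurableSet_Iic (a := t)).prod ((measurableSet_Iic (a := t)).prod
    (measurableSet_Iic (a := t)))
  have hνt : ν.restrict (Iic t) = volume.restrict (Ioc 0 t) := by
    rw [hν, Measure.restrict_restrict measurableSet_Iic]
    congr 1
    ext x
    simp only [mem_inter_iff, mem_Iic, mem_Ioc]
    constructor
    · exact fun h => ⟨h.2.1, h.1⟩
    · exact fun h => ⟨h.2, h.1, h.2.trans ht.2⟩
  simp only [Function.comp_apply, hS]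
  rw [MeasureTheory.integral_indicator hm, ← Measure.prod_restrict, ← Measure.prod_restrict, hνt,
    pairInt_eq_integral_prod hβ ht.1.le]

end FourFold
lemma I1_eq_pairInt {H : ℝ} (hH : 0 < H) {T : ℝ} (hT : 0 ≤ T) :
    I1 H T = 4 * ∫ t in (0:ℝ)..T, pairInt (2 * H - 1) t := by
  have hβ : -1 < 2 * H - 1 := by linarith
  have hF := integrable_quadKernel hβ T
  rw [← integral_quadKernel_eq_pairInt hβ hT, integral_prod _ hF, integral_prod _ hF.integral_prod_left,
    I1]
  simp only [intervalIntegral.integral_of_le hT]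
  congr 1
  ext t₁
  congr 1
  ext t₂
  rw [integral_prod]
  · congr 1
    ext s₁
    congr 1
    ext s₂
    rw [quadKernel, sub_eq_add_neg (-|t₁ - s₁|), exp_add, ← neg_sub t₁ s₁, ← neg_sub t₁ t₂,
      Real.sign_neg, Real.sign_neg, abs_neg, signedExp, signedExp, signedRpow, signedRpow]
    ring
  · refine ((integrable_abs_sub_rpow hβ T).const_mul (|t₁ - t₂| ^ (2 * H - 1))).mono' ?_
      (Eventually.of_forall fun p => abs_quadKernel_le ((t₁, t₂), p))
    exact (measurable_quadKernel.comp (by fun_prop)).aestronglyMeasurable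

section Asymptotics

variable {β : ℝ}

lemma tendsto_Gamma_sub_lowerGamma_mul_lowerGammaPrim (hβ : -1 < β) (hβ0 : β < 0) :
    Tendsto (fun T => (Gamma (β + 1) - lowerGamma β T) * lowerGammaPrim β T) atTop (𝓝 0) := by
  have h0 := tendsto_pow_mul_exp_neg_mul_expTail hβ hβ0 0
  have h1 := tendsto_pow_mul_exp_neg_mul_expTail hβ hβ0 1
  have hl := tendsto_lowerGamma hβ
  have hr := tendsto_rpow_mul_exp_neg (β + 1)
  have := ((h1.sub (h0.const_mul (β + 1))).mul hl).add (hr.mul h0)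
  simp only [mul_zero, sub_zero, zero_mul, add_zero, pow_zero, pow_one, one_mul] at this
  refine this.congr fun T => ?_
  rw [Gamma_sub_lowerGamma, lowerGammaPrim]
  ring

lemma tendsto_pairInt (hβ : -1 < β) (hβ0 : β < 0) {Q : ℝ}
    (hQ : Tendsto (sqInt β) atTop (𝓝 Q)) :
    Tendsto (pairInt β) atTop
      (𝓝 (Gamma (β + 1) ^ 2 / 4 + Q / 2 + Gamma (β + 1) ^ 2 * (β + 1 / 2))) := by
  have h := ((tendsto_mainPart hβ hβ0 hQ).sub (tendsto_corrConv hβ hβ0)).sub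
    (tendsto_Gamma_sub_lowerGamma_mul_lowerGammaPrim hβ hβ0)
  rw [sub_neg_eq_add, sub_zero] at h
  refine h.congr' ?_
  filter_upwards [eventually_ge_atTop 0] with T hT
  exact (pairInt_eq hβ hT).symm

lemma tendsto_integral_pairInt_sub (hβ : -1 < β) (hβ0 : β < 0) {Q : ℝ}
    (hQ : Tendsto (sqInt β) atTop (𝓝 Q)) :
    Tendsto (fun T => (∫ t in (0:ℝ)..T, pairInt β t) -
        T * (Gamma (β + 1) ^ 2 / 4 + Q / 2 + Gamma (β + 1) ^ 2 * (β + 1 / 2))) atTop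
      (𝓝 (-((β + 3 / 2) * (Gamma (β + 1) ^ 2 / 4 + Q / 2 + Gamma (β + 1) ^ 2 * (β + 1 / 2)))
        - Gamma (β + 1) ^ 2 * (β + 1) ^ 2 / 2)) := by
  have hm := (((tendsto_mul_sqInt_sub hβ hβ0 hQ).const_mul (1 / 2)).sub
    (hQ.const_mul ((β + 3 / 2) / 2))).sub (tendsto_boundaryTerm hβ hβ0)
  have hc := (tendsto_integral_corrConv_sub hβ hβ0).add
    ((tendsto_mul_integral_exp_neg_mul_convDiff hβ hβ0).const_mul (Gamma (β + 1)))
  have h := ((hm.sub_const ((β + 3 / 2) / 4 * Gamma (β + 1) ^ 2)).sub hc).sub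
    (tendsto_integral_mul_lowerGammaPrim hβ hβ0)
  refine (h.congr' ?_).mono_right (le_of_eq (congrArg 𝓝 (by ring)))
  filter_upwards [eventually_ge_atTop 0] with T hT
  rw [integral_pairInt hβ hT, integral_mainPart hβ hT]
  ring

end Asymptotics

end FourfoldIntegralAsymptotics

theorem stmt_6 (H : ℝ) (hH : H ∈ Set.Ioo (0 : ℝ) (1/2)) :
    Filter.Tendsto
      (fun T : ℝ => fBmNormSqM H T / 2 - (H * Real.Gamma (2 * H)) ^ 2 * sigmaH2 H * T)
      Filter.atTop
      (nhds (-((4 * H - 1) / 2) * ((H * Real.Gamma (2 * H)) ^ 2 * sigmaH2 H)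
        - (2 * H - 1) * (2 * H + 1) * (H * Real.Gamma (2 * H)) ^ 2)) := by
  obtain ⟨h0, h1⟩ := hH
  have hβ : -1 < 2 * H - 1 := by linarith
  have hβ0 : 2 * H - 1 < 0 := by linarith
  have hQ := tendsto_sqInt hβ hβ0
  simp only [sub_add_cancel] at hQ
  rw [Gamma_ratio_eq_sigmaH2 ⟨h0, h1⟩] at hQ
  have hI := tendsto_integral_pairInt_sub hβ hβ0 hQ
  have hJ := tendsto_pairInt hβ hβ0 hQ
  have hγ := (tendsto_lowerGamma hβ).pow 2
  have hg := (tendsto_expConv hβ hβ0).pow 2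
  have h := ((((hI.const_mul 2).add (hJ.const_mul 2)).add hγ).add hg).const_mul (H ^ 2)
  simp only [sub_add_cancel] at h
  refine (h.congr' ?_).mono_right (le_of_eq (congrArg nhds (by ring)))
  filter_upwards [Filter.eventually_ge_atTop 0] with T hT
  rw [fBmNormSqM, I1_eq_pairInt h0 hT, I2_eq_pairInt, I3, lowerGamma, expConv]
  ring
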